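/- arXiv:2108.04302 — 6 statements merged into one kernel-verified Lean document; each statement's English description precedes it below -/
import Mathlib

section
/- For every n ≥ 1, the number of leaves after n steps of the restricted generating tree of weak-ordering chains with stopping condition x_{i1} ≤ x_{i2} < x_{i3} (i1 < i2 < i3) equals Σ_{d=0}^{n−1} 2^d · N_{n,d} + Σ_{j=3}^{n} Σ_{d=1}^{j−2} 2^d · ℓ_{j,d}. -/
/-- A function `p : Fin n → Fin n` encodes an ordered set partition of `{1, …, n}`
when the set of values it attains is an initial segment of `Fin n`: `p i` is the
0-based index of the block containing `i` (so the 1-based position `pos(i)` of the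
block containing `i` equals `p i + 1`, and comparisons between `pos` values
correspond to comparisons between values of `p`). -/
def IsOSP {n : ℕ} (p : Fin n → Fin n) : Prop :=
  ∀ i v, v ≤ p i → ∃ j, p j = v

/-- The number of descents of a permutation `σ` of `Fin n`:
positions `i` (0-based) with `σ (i+1) < σ i`. -/
noncomputable def descents {n : ℕ} (σ : Equiv.Perm (Fin n)) : ℕ :=
  Nat.card {q : Fin n × Fin n // q.1.val + 1 = q.2.val ∧ σ q.2 < σ q.1}

/-- `σ` contains the pattern 213. -/
def Contains213 {n : ℕ} (σ : Equiv.Perm (Fin n)) : Prop :=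
  ∃ i j k : Fin n, i < j ∧ j < k ∧ σ j < σ i ∧ σ i < σ k

/-- The reduction of `σ` (obtained by deleting the largest entry from the
one-line notation of `σ`) avoids the pattern 213; equivalently, `σ` has no
occurrence of 213 using only entries different from the maximum value
(in an occurrence `σ j < σ i < σ k` only `σ k` can be the maximum). -/
def ReductionAvoids213 {n : ℕ} (σ : Equiv.Perm (Fin n)) : Prop :=
  ¬ ∃ i j k : Fin n, i < j ∧ j < k ∧ σ j < σ i ∧ σ i < σ k ∧ ∃ l, σ k < σ l

/-- `nar n d` is the number of 213-avoiding permutations of `[n]` with exactly `d`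
descents (the Narayana number `N_{n,d}`). -/
noncomputable def nar (n d : ℕ) : ℕ :=
  Nat.card {σ : Equiv.Perm (Fin n) // ¬ Contains213 σ ∧ descents σ = d}

/-- `l213 n d` is the number of permutations of `[n]` that contain the pattern 213,
have exactly `d` descents, and whose reduction (deleting the entry `n`) avoids 213. -/
noncomputable def l213 (n d : ℕ) : ℕ :=
  Nat.card {σ : Equiv.Perm (Fin n) //
    Contains213 σ ∧ descents σ = d ∧ ReductionAvoids213 σ}

/-- The ordered set partition encoded by `p` contains the condition
`x_{i1} ≤ x_{i2} < x_{i3}` with `i1 < i2 < i3`. -/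
def ChainLeLt {n : ℕ} (p : Fin n → Fin n) : Prop :=
  ∃ i j k : Fin n, i < j ∧ j < k ∧ p i ≤ p j ∧ p j < p k

/- Deleting the element `n` from an ordered set partition of `[n]` preserves block
membership and the relative order of the blocks of the remaining elements, so the
restriction to `[n-1]` contains a given stopping condition iff the condition occurs
with all of its witnesses among the elements of `[n-1]`, i.e. among the indices `i`
with `i.val < n - 1`. -/

/-- `Admissible ρ S M v`: the word `v` uses letters of `S`, and the word obtained by putting `M` in
front of `v` has no triple of letters, in order of position, related by `ρ`. -/
def Admissible {α : Type*} (ρ : α → α → α → Prop) (S : Finset α) (M : α) {r : ℕ}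
    (v : Fin r → α) : Prop :=
  (∀ i, v i ∈ S) ∧ (∀ j k, j < k → ¬ ρ M (v j) (v k)) ∧
    ∀ i j k, i < j → j < k → ¬ ρ (v i) (v j) (v k)

/-- The number of admissible words of length `r` when `a` letters below the current bound and
`b` letters not below it are available. -/
def treeCount : ℕ → ℕ → ℕ → ℕ
  | 0, _, _ => 1
  | r + 1, a, b =>
    ∑ i ∈ Finset.range b, treeCount r (a + i) (b - i) + ∑ i ∈ Finset.range a, treeCount r i b

theorem card_fin_succ_subtype {α : Type*} [Fintype α] {r : ℕ} (P : (Fin (r + 1) → α) → Prop) :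
    Nat.card {v // P v} = ∑ x, Nat.card {v : Fin r → α // P (Fin.cons x v)} := by
  rw [← Nat.card_sigma]
  exact Nat.card_congr
    { toFun := fun v => ⟨v.1 0, Fin.tail v.1, by rw [Fin.cons_self_tail]; exact v.2⟩
      invFun := fun v => ⟨Fin.cons v.1 v.2.1, v.2.2⟩
      left_inv := fun v => Subtype.ext (Fin.cons_self_tail v.1)
      right_inv := fun v => rfl }

theorem sum_card_filter_lt {α : Type*} [LinearOrder α] (F : Finset α) (g : ℕ → ℕ) :
    ∑ x ∈ F, g (F.filter (· < x)).card = ∑ i ∈ Finset.range F.card, g i := by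
  induction F using Finset.induction_on_max with
  | empty => simp
  | insert a s ha ih =>
    have hn : a ∉ s := fun h => lt_irrefl _ (ha a h)
    rw [Finset.sum_insert hn, Finset.card_insert_of_notMem hn, Finset.sum_range_succ, ← ih,
      add_comm]
    congr 1
    · refine Finset.sum_congr rfl fun x hx => ?_
      rw [Finset.filter_insert, if_neg (ha x hx).not_gt]
    · rw [Finset.filter_insert, if_neg (lt_irrefl a), Finset.filter_true_of_mem ha]

theorem sum_card_filter_gt {α : Type*} [LinearOrder α] (F : Finset α) (g : ℕ → ℕ) :
    ∑ x ∈ F, g (F.filter (x < ·)).card = ∑ i ∈ Finset.range F.card, g i :=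
  sum_card_filter_lt (α := αᵒᵈ) F g

theorem admissible_cons {α : Type*} [LinearOrder α] {ρ : α → α → α → Prop}
    [∀ a b c, Decidable (ρ a b c)]
    (hlt : ∀ M u v, ρ M u v → u < M) (hmono : ∀ M M' u v, M ≤ M' → ρ M u v → ρ M' u v)
    (S : Finset α) (M x : α) {r : ℕ} (v : Fin r → α) :
    Admissible ρ S M (Fin.cons x v : Fin (r + 1) → α) ↔
      x ∈ S ∧ if M ≤ x then Admissible ρ S x v
        else Admissible ρ (S.filter fun y => ¬ ρ M x y) M v := by
  unfold Admissible
  simp only [Fin.forall_fin_succ, Fin.cons_zero, Fin.cons_succ, Fin.succ_lt_succ_iff,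
    Fin.succ_pos, Fin.not_lt_zero, forall_const, IsEmpty.forall_iff, implies_true,
    true_and, Finset.mem_filter]
  split_ifs with h
  · constructor
    · rintro ⟨⟨h1, h2⟩, ⟨h3, h4⟩, h5, h6⟩
      exact ⟨h1, h2, h5, h6⟩
    · rintro ⟨h1, h2, h5, h6⟩
      exact ⟨⟨h1, h2⟩, ⟨fun j hj => (hlt _ _ _ hj).not_ge h,
        fun j k hjk hr => h5 j k hjk (hmono _ _ _ _ h hr)⟩, h5, h6⟩
  · constructor
    · rintro ⟨⟨h1, h2⟩, ⟨h3, h4⟩, h5, h6⟩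
      exact ⟨h1, fun i => ⟨h2 i, h3 i⟩, h4, h6⟩
    · rintro ⟨h1, h2, h4, h6⟩
      exact ⟨⟨h1, fun i => (h2 i).1⟩, ⟨fun i => (h2 i).2, h4⟩,
        fun j k hjk hr => h4 j k hjk (hmono _ _ _ _ (not_le.1 h).le hr), h6⟩

theorem card_admissible {α : Type*} [LinearOrder α] [Fintype α] {ρ : α → α → α → Prop}
    [∀ a b c, Decidable (ρ a b c)]
    (hlt : ∀ M u v, ρ M u v → u < M ∧ v < M)
    (hmono : ∀ M M' u v, M ≤ M' → ρ M u v → ρ M' u v)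
    (hsum : ∀ (S : Finset α) (M : α) (g : ℕ → ℕ),
      ∑ x ∈ S.filter (· < M), g ((S.filter fun y => ¬ ρ M x y).filter (· < M)).card =
        ∑ i ∈ Finset.range (S.filter (· < M)).card, g i)
    (r : ℕ) (S : Finset α) (M : α) :
    Nat.card {v : Fin r → α // Admissible ρ S M v} =
      treeCount r (S.filter (· < M)).card (S.filter (M ≤ ·)).card := by
  induction r generalizing S M with
  | zero =>
    have : Unique {v : Fin 0 → α // Admissible ρ S M v} :=
      { default := ⟨Fin.elim0, by simp [Admissible]⟩
        uniq := fun v => Subtype.ext (Subsingleton.elim _ _) }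
    simp [treeCount]
  | succ r ih =>
    rw [card_fin_succ_subtype]
    simp only [admissible_cons (fun M u v h => (hlt M u v h).1) hmono]
    have key : ∀ x, Nat.card {v : Fin r → α // x ∈ S ∧ if M ≤ x then Admissible ρ S x v
        else Admissible ρ (S.filter fun y => ¬ ρ M x y) M v} =
        if x ∈ S then (if M ≤ x then
          treeCount r (S.filter (· < x)).card (S.filter (x ≤ ·)).card
        else treeCount r ((S.filter fun y => ¬ ρ M x y).filter (· < M)).card
          ((S.filter fun y => ¬ ρ M x y).filter (M ≤ ·)).card) else 0 := by
      intro x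
      by_cases h1 : x ∈ S
      · by_cases h2 : M ≤ x
        · simp only [h1, h2, true_and, if_true]; exact ih _ _
        · simp only [h1, h2, true_and, if_true, if_false]; exact ih _ _
      · simp [h1]
    simp only [key]
    rw [← Finset.sum_filter, Finset.filter_univ_mem,
      ← Finset.sum_filter_add_sum_filter_not S (M ≤ ·), treeCount]
    congr 1
    · rw [← sum_card_filter_lt (S.filter (M ≤ ·)) fun i =>
        treeCount r ((S.filter (· < M)).card + i) ((S.filter (M ≤ ·)).card - i)]
      refine Finset.sum_congr rfl fun x hx => ?_
      have hx := (Finset.mem_filter.1 hx).2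
      rw [if_pos hx]
      have e1 : S.filter (· < x) = S.filter (· < M) ∪ (S.filter (M ≤ ·)).filter (· < x) := by
        ext y
        simp only [Finset.mem_filter, Finset.mem_union]
        rcases lt_or_ge y M with h | h
        · simp [h, h.trans_le hx]
        · simp [h, h.not_gt]
      have e2 : S.filter (M ≤ ·) = S.filter (x ≤ ·) ∪ (S.filter (M ≤ ·)).filter (· < x) := by
        ext y
        simp only [Finset.mem_filter, Finset.mem_union]
        rcases lt_or_ge y x with h | h
        · simp [h, h.not_ge]
        · simp [h, hx.trans h]
      have d1 : Disjoint (S.filter (· < M)) ((S.filter (M ≤ ·)).filter (· < x)) := by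
        rw [Finset.disjoint_left]
        intro y hy hy'
        simp only [Finset.mem_filter] at hy hy'
        exact hy'.1.2.not_gt hy.2
      have d2 : Disjoint (S.filter (x ≤ ·)) ((S.filter (M ≤ ·)).filter (· < x)) := by
        rw [Finset.disjoint_left]
        intro y hy hy'
        simp only [Finset.mem_filter] at hy hy'
        exact hy'.2.not_ge hy.2
      have c1 := Finset.card_union_of_disjoint d1
      have c2 := Finset.card_union_of_disjoint d2
      rw [← e1] at c1
      rw [← e2] at c2
      rw [c1, c2, Nat.add_sub_cancel]
    · have hf : S.filter (fun x => ¬ M ≤ x) = S.filter (· < M) := by simp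
      rw [hf, ← hsum S M fun i => treeCount r i (S.filter (M ≤ ·)).card]
      refine Finset.sum_congr rfl fun x hx => ?_
      rw [if_neg (Finset.mem_filter.1 hx).2.not_ge]
      congr 2
      ext y
      simp only [Finset.mem_filter]
      exact ⟨fun h => ⟨h.1.1, h.2⟩, fun h => ⟨⟨h.1, fun hr => (hlt _ _ _ hr).2.not_ge h.2⟩, h.2⟩⟩

theorem card_admissible_eq {α : Type*} [LinearOrder α] [Fintype α] (r : ℕ) (S : Finset α)
    (M : α) :
    Nat.card {v : Fin r → α // Admissible (fun M u v => v ≤ u ∧ u < M) S M v} =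
      Nat.card {v : Fin r → α // Admissible (fun M u v => u ≤ v ∧ v < M) S M v} := by
  rw [card_admissible (fun M u v h => ⟨h.2, h.1.trans_lt h.2⟩)
      (fun M M' u v hM h => ⟨h.1, h.2.trans_le hM⟩),
    card_admissible (fun M u v h => ⟨h.1.trans_lt h.2, h.2⟩)
      (fun M M' u v hM h => ⟨h.1, h.2.trans_le hM⟩)]
  · intro S M g
    rw [← sum_card_filter_lt]
    refine Finset.sum_congr rfl fun x hx => ?_
    congr 2
    ext y
    simp only [Finset.mem_filter] at hx ⊢
    grind
  · intro S M g
    rw [← sum_card_filter_gt]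
    refine Finset.sum_congr rfl fun x hx => ?_
    congr 2
    ext y
    simp only [Finset.mem_filter] at hx ⊢
    grind

/-- The word `w` contains letters `w j ≤ w i < w k` at positions `i < j < k`. -/
def SwappedLeLt {α : Type*} [LinearOrder α] {m : ℕ} (w : Fin m → α) : Prop :=
  ∃ i j k : Fin m, i < j ∧ j < k ∧ w j ≤ w i ∧ w i < w k

/-- The word `w` contains letters `w i ≤ w j < w k` at positions `i < j < k`. -/
def LeLt {α : Type*} [LinearOrder α] {m : ℕ} (w : Fin m → α) : Prop :=
  ∃ i j k : Fin m, i < j ∧ j < k ∧ w i ≤ w j ∧ w j < w k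

theorem card_not_leLt_subset {α : Type*} [LinearOrder α] [Fintype α] [OrderBot α] (m : ℕ)
    (R : Finset α) :
    Nat.card {w : Fin m → α // Finset.univ.image w ⊆ R ∧ ¬ LeLt w} =
      Nat.card {w : Fin m → α // Finset.univ.image w ⊆ R ∧ ¬ SwappedLeLt w} := by
  have h := card_admissible_eq m R ⊥
  have c1 : Nat.card {w : Fin m → α // Finset.univ.image w ⊆ R ∧ ¬ LeLt w} =
      Nat.card {v : Fin m → α // Admissible (fun M u v => v ≤ u ∧ u < M) R ⊥ v} := by
    refine Nat.card_congr (Equiv.subtypeEquiv (Equiv.arrowCongr Fin.revPerm (Equiv.refl α)) ?_)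
    intro w
    simp only [Admissible, LeLt, Finset.image_subset_iff, Finset.mem_univ, true_imp_iff]
    refine and_congr ?_ ?_
    · simpa using (Fin.revPerm.forall_congr_right (q := fun i => w i ∈ R)).symm
    · simp only [not_lt_bot, and_false, not_false_eq_true, implies_true, true_and]
      constructor
      · rintro h i j k hij hjk hw
        exact h ⟨k.rev, j.rev, i.rev, by simpa, by simpa, hw.1, hw.2⟩
      · rintro h ⟨i, j, k, hij, hjk, hw⟩
        exact h k.rev j.rev i.rev (by simpa) (by simpa) (by simpa using hw)
  have c2 : Nat.card {w : Fin m → α // Finset.univ.image w ⊆ R ∧ ¬ SwappedLeLt w} =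
      Nat.card {v : Fin m → α // Admissible (fun M u v => u ≤ v ∧ v < M) R ⊥ v} := by
    refine Nat.card_congr (Equiv.subtypeEquiv (Equiv.arrowCongr Fin.revPerm (Equiv.refl α)) ?_)
    intro w
    simp only [Admissible, SwappedLeLt, Finset.image_subset_iff, Finset.mem_univ, true_imp_iff]
    refine and_congr ?_ ?_
    · simpa using (Fin.revPerm.forall_congr_right (q := fun i => w i ∈ R)).symm
    · simp only [not_lt_bot, and_false, not_false_eq_true, implies_true, true_and]
      constructor
      · rintro h i j k hij hjk hw
        exact h ⟨k.rev, j.rev, i.rev, by simpa, by simpa, hw.1, hw.2⟩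
      · rintro h ⟨i, j, k, hij, hjk, hw⟩
        exact h k.rev j.rev i.rev (by simpa) (by simpa) (by simpa using hw)
  rw [c1, c2, h]

theorem card_subtype_fiberwise {β γ : Type*} [Fintype β] [DecidableEq γ] (f : β → γ)
    (T : Finset γ) (P : β → Prop) :
    Nat.card {b // f b ∈ T ∧ P b} = ∑ c ∈ T, Nat.card {b // f b = c ∧ P b} := by
  classical
  simp only [Nat.card_eq_fintype_card, Fintype.card_subtype]
  rw [Finset.card_eq_sum_card_fiberwise (f := f) (t := T) (fun b hb => by simp_all)]
  refine Finset.sum_congr rfl fun c hc => ?_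
  congr 1
  ext b
  simp only [Finset.mem_filter, Finset.mem_univ, true_and]
  grind

theorem card_not_leLt_image {α : Type*} [LinearOrder α] [Fintype α] [OrderBot α] (m : ℕ)
    (R : Finset α) :
    Nat.card {w : Fin m → α // Finset.univ.image w = R ∧ ¬ LeLt w} =
      Nat.card {w : Fin m → α // Finset.univ.image w = R ∧ ¬ SwappedLeLt w} := by
  induction R using Finset.strongInduction with
  | H R ih =>
    have h := card_not_leLt_subset m R
    simp only [← Finset.mem_powerset] at h
    rw [card_subtype_fiberwise, card_subtype_fiberwise,
      ← Finset.add_sum_erase _ _ (Finset.mem_powerset_self R),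
      ← Finset.add_sum_erase _ _ (Finset.mem_powerset_self R)] at h
    rw [Finset.sum_congr rfl fun c hc => ih c ?_] at h
    · exact Nat.add_right_cancel h
    · rw [Finset.mem_erase, Finset.mem_powerset] at hc
      exact Finset.ssubset_iff_subset_ne.2 ⟨hc.2, hc.1⟩

/-- Avoiding `LeLt` and avoiding `SwappedLeLt` are equidistributed with respect to the set of
letters of a word. -/
theorem card_not_leLt_eq {α : Type*} [LinearOrder α] [Fintype α] [OrderBot α] (m : ℕ)
    (Q : Finset α → Prop) :
    Nat.card {w : Fin m → α // Q (Finset.univ.image w) ∧ ¬ LeLt w} =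
      Nat.card {w : Fin m → α // Q (Finset.univ.image w) ∧ ¬ SwappedLeLt w} := by
  classical
  have h := Finset.sum_congr (s₁ := Finset.univ.filter Q) rfl
    fun R _ => card_not_leLt_image (α := α) m R
  rw [← card_subtype_fiberwise, ← card_subtype_fiberwise] at h
  simpa only [Finset.mem_filter, Finset.mem_univ, true_and] using h

/-- The ordering `σ` lists the elements block by block, each block in decreasing order. -/
def ListsBlocks {n : ℕ} (σ : Equiv.Perm (Fin n)) (p : Fin n → Fin n) : Prop :=
  StrictMono fun i => toLex (p (σ i), OrderDual.toDual (σ i))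

theorem existsUnique_perm_strictMono {n : ℕ} {β : Type*} [LinearOrder β] {f : Fin n → β}
    (hf : Function.Injective f) : ∃! σ : Equiv.Perm (Fin n), StrictMono fun i => f (σ i) := by
  refine ⟨Tuple.sort f, (Tuple.monotone_sort f).strictMono_of_injective
    (hf.comp (Tuple.sort f).injective), fun τ hτ => ?_⟩
  have hs : StrictMono fun i => f (Tuple.sort f i) :=
    (Tuple.monotone_sort f).strictMono_of_injective (hf.comp (Tuple.sort f).injective)
  have hr : Set.range (fun i => f (τ i)) = Set.range fun i => f (Tuple.sort f i) := by
    rw [show (fun i => f (τ i)) = f ∘ τ from rfl,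
      show (fun i => f (Tuple.sort f i)) = f ∘ Tuple.sort f from rfl,
      Set.range_comp, Set.range_comp, τ.surjective.range_eq,
      (Tuple.sort f).surjective.range_eq]
  have h := (hτ.range_inj hs).1 hr
  exact Equiv.ext fun i => hf (congrFun h i)

theorem existsUnique_lists {n : ℕ} (p : Fin n → Fin n) : ∃! σ, ListsBlocks σ p :=
  existsUnique_perm_strictMono (f := fun i => toLex (p i, OrderDual.toDual i))
    fun i j h => by simpa using congrArg (fun x => OrderDual.ofDual (ofLex x).2) h

theorem ListsBlocks.symm_lt_symm {n : ℕ} {σ : Equiv.Perm (Fin n)} {p : Fin n → Fin n}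
    (h : ListsBlocks σ p) {a b : Fin n} :
    σ.symm a < σ.symm b ↔ p a < p b ∨ p a = p b ∧ b < a := by
  rw [← StrictMono.lt_iff_lt h]
  simp [Prod.Lex.toLex_lt_toLex]

theorem descents_eq {m : ℕ} (σ : Equiv.Perm (Fin (m + 1))) :
    descents σ = (Finset.univ.filter fun i : Fin m => σ i.succ < σ i.castSucc).card := by
  rw [descents, ← Fintype.card_subtype, ← Nat.card_eq_fintype_card]
  refine (Nat.card_congr (Equiv.ofBijective
    (fun i => ⟨(i.1.castSucc, i.1.succ), rfl, i.2⟩) ⟨?_, ?_⟩)).symm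
  · rintro ⟨i, hi⟩ ⟨j, hj⟩ h
    simpa using h
  · rintro ⟨⟨a, b⟩, hab, h⟩
    dsimp only at hab h
    have e1 : a = Fin.castSucc ⟨a.val, by omega⟩ := rfl
    have e2 : b = Fin.succ ⟨a.val, by omega⟩ := Fin.ext hab.symm
    refine ⟨⟨⟨a.val, by omega⟩, ?_⟩, ?_⟩
    · rw [← e1, ← e2]; exact h
    · exact Subtype.ext (Prod.ext e1.symm e2.symm)

theorem isOSP_and_strictMono_iff {m : ℕ} (σ : Equiv.Perm (Fin (m + 1)))
    (q : Fin (m + 1) → Fin (m + 1)) :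
    (IsOSP q ∧ StrictMono fun i => toLex (q i, OrderDual.toDual (σ i))) ↔
      q 0 = 0 ∧ ∀ i : Fin m, (q i.succ = q i.castSucc ∧ σ i.succ < σ i.castSucc) ∨
        (q i.succ).val = (q i.castSucc).val + 1 := by
  constructor
  · rintro ⟨ho, hs⟩
    have hm : Monotone q := fun i j hij => by
      have := hs.monotone hij
      rw [Prod.Lex.toLex_le_toLex] at this
      rcases this with h | h
      · exact h.le
      · exact h.1.le
    refine ⟨?_, fun i => ?_⟩
    · obtain ⟨j, hj⟩ := ho 0 0 (Fin.zero_le _)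
      exact Fin.le_zero_iff.1 ((hm (Fin.zero_le j)).trans_eq hj)
    · have h := hs i.castSucc_lt_succ
      simp only [Prod.Lex.toLex_lt_toLex, OrderDual.toDual_lt_toDual] at h
      rcases h with h | h
      · right
        by_contra hne
        have hlt : (q i.castSucc).val + 1 < (q i.succ).val := by
          have : (q i.castSucc).val < (q i.succ).val := h
          omega
        obtain ⟨j, hj⟩ := ho i.succ ⟨(q i.castSucc).val + 1, by omega⟩ hlt.le
        have hj := congrArg Fin.val hj
        dsimp only at hj
        rcases le_or_gt j i.castSucc with hji | hji
        · have : (q j).val ≤ (q i.castSucc).val := hm hji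
          omega
        · have : (q i.succ).val ≤ (q j).val := hm (Fin.castSucc_lt_iff_succ_le.1 hji)
          omega
      · exact Or.inl ⟨h.1.symm, h.2⟩
  · rintro ⟨h0, hs⟩
    constructor
    · intro k
      induction k using Fin.induction with
      | zero => exact fun v hv => ⟨0, by rw [h0] at hv ⊢; exact (Fin.le_zero_iff.1 hv).symm⟩
      | succ i ih =>
        intro v hv
        rcases hs i with h | h
        · exact ih v (h.1 ▸ hv)
        · rcases hv.eq_or_lt with e | e
          · exact ⟨_, e.symm⟩
          · refine ih v ?_
            have : v.val < (q i.succ).val := e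
            exact Fin.le_def.2 (by omega)
    · rw [Fin.strictMono_iff_lt_succ]
      intro i
      simp only [Prod.Lex.toLex_lt_toLex, OrderDual.toDual_lt_toDual]
      rcases hs i with h | h
      · exact Or.inr ⟨h.1.symm, h.2⟩
      · exact Or.inl (Fin.lt_def.2 (by omega))

/-- The staircase function increasing by one at each step outside `U`. -/
def stair {m : ℕ} (U : Finset (Fin m)) (k : Fin (m + 1)) : Fin (m + 1) :=
  ⟨(Finset.univ.filter fun i : Fin m => i.castSucc < k ∧ i ∉ U).card,
    Nat.lt_succ_of_le ((Finset.card_filter_le _ _).trans (by simp))⟩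

theorem stair_zero {m : ℕ} (U : Finset (Fin m)) : stair U 0 = 0 := by
  ext; simp [stair]

theorem stair_succ {m : ℕ} (U : Finset (Fin m)) (i : Fin m) :
    (stair U i.succ).val = (stair U i.castSucc).val + if i ∈ U then 0 else 1 := by
  simp only [stair]
  split_ifs with h
  · rw [add_zero]
    congr 1
    ext l
    simp only [Finset.mem_filter, Finset.mem_univ, true_and]
    grind [Fin.castSucc_lt_succ_iff, Fin.castSucc_lt_castSucc_iff]
  · rw [← Finset.card_insert_of_notMem (a := i) (by simp)]
    congr 1
    ext l
    simp only [Finset.mem_filter, Finset.mem_univ, true_and, Finset.mem_insert]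
    grind [Fin.castSucc_lt_succ_iff, Fin.castSucc_lt_castSucc_iff]

theorem card_isOSP_lists {m : ℕ} (σ : Equiv.Perm (Fin (m + 1))) :
    Nat.card {p // ListsBlocks σ p ∧ IsOSP p} = 2 ^ descents σ := by
  have h1 : Nat.card {p // ListsBlocks σ p ∧ IsOSP p} =
      Nat.card {q : Fin (m + 1) → Fin (m + 1) // q 0 = 0 ∧ ∀ i : Fin m,
        (q i.succ = q i.castSucc ∧ σ i.succ < σ i.castSucc) ∨
          (q i.succ).val = (q i.castSucc).val + 1} := by
    refine Nat.card_congr (Equiv.subtypeEquiv (Equiv.arrowCongr σ.symm (Equiv.refl _)) ?_)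
    intro p
    rw [← isOSP_and_strictMono_iff, and_comm]
    refine and_congr ?_ Iff.rfl
    refine ⟨fun h i v hv => ?_, fun h i v hv => ?_⟩
    · obtain ⟨j, hj⟩ := h (σ i) v hv
      exact ⟨σ.symm j, by simpa using hj⟩
    · obtain ⟨j, hj⟩ := h (σ.symm i) v (by simpa using hv)
      exact ⟨σ j, hj⟩
  set D := Finset.univ.filter fun i : Fin m => σ i.succ < σ i.castSucc with hD
  rw [h1, descents_eq, ← hD, ← Finset.card_powerset, ← Fintype.card_coe,
    ← Nat.card_eq_fintype_card]
  exact Nat.card_congr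
    { toFun := fun q => ⟨Finset.univ.filter fun i => q.1 i.succ = q.1 i.castSucc, by
        rw [Finset.mem_powerset]
        intro i hi
        simp only [hD, Finset.mem_filter, Finset.mem_univ, true_and] at hi ⊢
        rcases q.2.2 i with h | h
        · exact h.2
        · rw [hi] at h; omega⟩
      invFun := fun U => ⟨stair U.1, stair_zero _, fun i => by
        have h := stair_succ U.1 i
        by_cases hi : i ∈ U.1
        · rw [if_pos hi] at h
          have := Finset.mem_powerset.1 U.2 hi
          exact Or.inl ⟨Fin.ext h, by simpa [hD] using this⟩
        · rw [if_neg hi] at h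
          exact Or.inr h⟩
      left_inv := fun q => by
        refine Subtype.ext (funext fun k => ?_)
        dsimp only
        induction k using Fin.induction with
        | zero => rw [stair_zero, q.2.1]
        | succ i ih =>
          ext
          rw [stair_succ, ih]
          rcases q.2.2 i with h | h
          · simp [h.1]
          · have hne : q.1 i.succ ≠ q.1 i.castSucc := fun e => by rw [e] at h; omega
            simp [h, hne]
      right_inv := fun U => by
        refine Subtype.ext ?_
        ext i
        have h := stair_succ U.1 i
        simp only [Finset.mem_filter, Finset.mem_univ, true_and]
        by_cases hi : i ∈ U.1
        · rw [if_pos hi] at h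
          exact iff_of_true (Fin.ext h) hi
        · rw [if_neg hi] at h
          exact iff_of_false (fun e => by rw [e] at h; omega) hi }

theorem descents_le {m : ℕ} (σ : Equiv.Perm (Fin (m + 1))) : descents σ ≤ m := by
  rw [descents_eq]
  exact (Finset.card_filter_le _ _).trans (by simp)

/-- Counting ordered set partitions by the permutation listing their blocks. -/
theorem card_isOSP_eq_sum {m : ℕ} (P : Equiv.Perm (Fin (m + 1)) → Prop)
    (Q : (Fin (m + 1) → Fin (m + 1)) → Prop) (hPQ : ∀ σ p, ListsBlocks σ p → (P σ ↔ Q p)) :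
    Nat.card {p // Q p ∧ IsOSP p} =
      ∑ d ∈ Finset.range (m + 1), 2 ^ d * Nat.card {σ // P σ ∧ descents σ = d} := by
  classical
  choose f hf hu using existsUnique_lists (n := m + 1)
  have h1 : Nat.card {p // Q p ∧ IsOSP p} =
      Nat.card {p // f p ∈ Finset.univ.filter P ∧ IsOSP p} := by
    simp only [Finset.mem_filter, Finset.mem_univ, true_and, fun p => hPQ _ _ (hf p)]
  have h2 : ∀ σ p, f p = σ ↔ ListsBlocks σ p := fun σ p =>
    ⟨fun h => h ▸ hf p, fun h => (hu p σ h).symm⟩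
  rw [h1, card_subtype_fiberwise]
  simp only [h2, card_isOSP_lists]
  rw [← Finset.sum_fiberwise_of_maps_to (g := descents) (t := Finset.range (m + 1))
    fun σ _ => Finset.mem_range.2 (Nat.lt_succ_of_le (descents_le σ))]
  refine Finset.sum_congr rfl fun d _ => ?_
  rw [Nat.card_eq_fintype_card, Fintype.card_subtype, Finset.filter_filter,
    Finset.sum_congr rfl fun σ hσ => by rw [(Finset.mem_filter.1 hσ).2.2], Finset.sum_const,
    smul_eq_mul, mul_comm]

theorem ListsBlocks.contains213_iff {n : ℕ} {σ : Equiv.Perm (Fin n)} {p : Fin n → Fin n}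
    (h : ListsBlocks σ p) (K : Fin n → Prop) :
    (∃ i j k : Fin n, i < j ∧ j < k ∧ σ j < σ i ∧ σ i < σ k ∧ K (σ k)) ↔
      ∃ a b c : Fin n, a < b ∧ b < c ∧ p b ≤ p a ∧ p a < p c ∧ K c := by
  constructor
  · rintro ⟨i, j, k, hij, hjk, h1, h2, h3⟩
    have e1 := h.symm_lt_symm (a := σ i) (b := σ j)
    have e2 := h.symm_lt_symm (a := σ j) (b := σ k)
    simp only [Equiv.symm_apply_apply, hij, hjk, true_iff] at e1 e2
    refine ⟨σ j, σ i, σ k, h1, h2, e1.elim le_of_lt fun e => e.1.le, ?_, h3⟩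
    exact e2.resolve_right fun e => lt_asymm e.2 (h1.trans h2)
  · rintro ⟨a, b, c, hab, hbc, h1, h2, h3⟩
    refine ⟨σ.symm b, σ.symm a, σ.symm c, h.symm_lt_symm.2 ?_, h.symm_lt_symm.2 (Or.inl h2),
      by simpa, by simpa, by simpa⟩
    exact h1.lt_or_eq.imp id fun e => ⟨e, hab⟩

theorem ListsBlocks.contains213_iff_swappedLeLt {n : ℕ} {σ : Equiv.Perm (Fin n)}
    {p : Fin n → Fin n} (h : ListsBlocks σ p) : Contains213 σ ↔ SwappedLeLt p := by
  simpa [Contains213, SwappedLeLt] using h.contains213_iff fun _ => True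

theorem exists_init_iff {m : ℕ} (T : Fin (m + 1) → Fin (m + 1) → Fin (m + 1) → Prop) :
    (∃ a b c : Fin m, a < b ∧ b < c ∧ T a.castSucc b.castSucc c.castSucc) ↔
      ∃ a b c : Fin (m + 1), a < b ∧ b < c ∧ T a b c ∧ c.val < m := by
  constructor
  · rintro ⟨a, b, c, hab, hbc, h⟩
    exact ⟨a.castSucc, b.castSucc, c.castSucc, hab, hbc, h, c.2⟩
  · rintro ⟨a, b, c, hab, hbc, h, hc⟩
    have hb : b.val < m := lt_trans hbc hc
    exact ⟨⟨a, lt_trans hab hb⟩, ⟨b, hb⟩, ⟨c, hc⟩, hab, hbc, h⟩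

theorem ListsBlocks.reductionAvoids213_iff {m : ℕ} {σ : Equiv.Perm (Fin (m + 1))}
    {p : Fin (m + 1) → Fin (m + 1)} (h : ListsBlocks σ p) :
    ReductionAvoids213 σ ↔ ¬ SwappedLeLt (Fin.init p) := by
  have hK : ∀ c : Fin (m + 1), (∃ l, c < σ l) ↔ c.val < m := fun c =>
    ⟨fun ⟨l, hl⟩ => lt_of_lt_of_le hl (Nat.le_of_lt_succ (σ l).2),
      fun hc => ⟨σ.symm (Fin.last m), by simpa using Fin.lt_def.2 hc⟩⟩
  have h1 := h.contains213_iff fun c => c.val < m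
  have h2 := exists_init_iff fun a b c => p b ≤ p a ∧ p a < p c
  simp only [and_assoc] at h2
  rw [ReductionAvoids213, SwappedLeLt]
  simp only [hK, Fin.init]
  rw [h1, h2]

theorem leLt_init_iff {m : ℕ} (p : Fin (m + 1) → Fin (m + 1)) :
    (∃ a b c : Fin (m + 1), a.val < m + 1 - 1 ∧ b.val < m + 1 - 1 ∧ c.val < m + 1 - 1 ∧
      a < b ∧ b < c ∧ p a ≤ p b ∧ p b < p c) ↔ LeLt (Fin.init p) := by
  have h2 := exists_init_iff fun a b c => p a ≤ p b ∧ p b < p c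
  simp only [and_assoc] at h2
  rw [LeLt]
  simp only [Fin.init]
  rw [h2]
  constructor
  · rintro ⟨a, b, c, -, -, hc, h⟩
    exact ⟨a, b, c, h.1, h.2.1, h.2.2.1, h.2.2.2, hc⟩
  · rintro ⟨a, b, c, hab, hbc, h, h', hc⟩
    have hb : b.val < m := lt_trans hbc hc
    exact ⟨a, b, c, lt_trans hab hb, hb, hc, hab, hbc, h, h'⟩

theorem isOSP_iff_image {n : ℕ} (p : Fin n → Fin n) :
    IsOSP p ↔ ∀ u ∈ Finset.univ.image p, ∀ v ≤ u, v ∈ Finset.univ.image p := by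
  simp [IsOSP]

theorem card_isOSP_not_leLt (m : ℕ) :
    Nat.card {p : Fin (m + 1) → Fin (m + 1) // IsOSP p ∧ ¬ LeLt p} =
      Nat.card {p : Fin (m + 1) → Fin (m + 1) // IsOSP p ∧ ¬ SwappedLeLt p} := by
  simp only [isOSP_iff_image]
  exact card_not_leLt_eq (m + 1) fun R => ∀ u ∈ R, ∀ v ≤ u, v ∈ R

theorem card_snoc_subtype {α : Type*} [Fintype α] {r : ℕ} (P : (Fin (r + 1) → α) → Prop) :
    Nat.card {v // P v} = ∑ x, Nat.card {v : Fin r → α // P (Fin.snoc v x)} := by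
  rw [← Nat.card_sigma]
  refine Nat.card_congr (((Fin.snocEquiv fun _ => α).subtypeEquiv fun y => ?_).symm.trans
    (Equiv.subtypeProdEquivSigmaSubtype fun x (w : Fin r → α) =>
      P (Fin.snoc (α := fun _ => α) w x)))
  rfl

theorem image_snoc {α : Type*} [DecidableEq α] {r : ℕ} (w : Fin r → α) (x : α) :
    Finset.univ.image (Fin.snoc w x : Fin (r + 1) → α) = insert x (Finset.univ.image w) := by
  ext y
  simp only [Finset.mem_image, Finset.mem_univ, true_and, Finset.mem_insert]
  rw [Fin.exists_fin_succ']
  simp [eq_comm, or_comm]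

theorem card_isOSP_init_not_leLt (m : ℕ) :
    Nat.card {p : Fin (m + 1) → Fin (m + 1) // IsOSP p ∧ ¬ LeLt (Fin.init p)} =
      Nat.card {p : Fin (m + 1) → Fin (m + 1) // IsOSP p ∧ ¬ SwappedLeLt (Fin.init p)} := by
  rw [card_snoc_subtype, card_snoc_subtype]
  simp only [isOSP_iff_image, image_snoc, Fin.init_snoc]
  exact Finset.sum_congr rfl fun x _ =>
    card_not_leLt_eq m fun R => ∀ u ∈ insert x R, ∀ v ≤ u, v ∈ insert x R

theorem card_and_not_add {β : Type*} [Finite β] (O A B : β → Prop) (hAB : ∀ b, ¬ A b → ¬ B b) :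
    Nat.card {b // O b ∧ A b ∧ ¬ B b} + Nat.card {b // O b ∧ ¬ A b} =
      Nat.card {b // O b ∧ ¬ B b} := by
  classical
  have := Fintype.ofFinite β
  simp only [Nat.card_eq_fintype_card, Fintype.card_subtype]
  rw [← Finset.card_union_of_disjoint]
  · congr 1
    ext b
    have := hAB b
    simp only [Finset.mem_union, Finset.mem_filter, Finset.mem_univ, true_and]
    tauto
  · rw [Finset.disjoint_left]
    intro b
    simp only [Finset.mem_filter, Finset.mem_univ, true_and]
    tauto

theorem card_isOSP_leLt_not_init (m : ℕ) :
    Nat.card {p : Fin (m + 1) → Fin (m + 1) // IsOSP p ∧ LeLt p ∧ ¬ LeLt (Fin.init p)} =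
      Nat.card {p : Fin (m + 1) → Fin (m + 1) //
        IsOSP p ∧ SwappedLeLt p ∧ ¬ SwappedLeLt (Fin.init p)} := by
  have h1 := card_and_not_add (β := Fin (m + 1) → Fin (m + 1)) IsOSP LeLt
    (fun p => LeLt (Fin.init p)) fun p hp ⟨a, b, c, h⟩ =>
      hp ⟨a.castSucc, b.castSucc, c.castSucc, h⟩
  have h2 := card_and_not_add (β := Fin (m + 1) → Fin (m + 1)) IsOSP SwappedLeLt
    (fun p => SwappedLeLt (Fin.init p)) fun p hp ⟨a, b, c, h⟩ =>
      hp ⟨a.castSucc, b.castSucc, c.castSucc, h⟩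
  rw [card_isOSP_not_leLt, card_isOSP_init_not_leLt] at h1
  exact Nat.add_right_cancel (h1.trans h2.symm)

theorem Contains213.descents_mem {m : ℕ} {σ : Equiv.Perm (Fin (m + 1))} (h : Contains213 σ) :
    1 ≤ descents σ ∧ descents σ < m := by
  obtain ⟨i, j, k, hij, hjk, h1, h2⟩ := h
  rw [descents_eq]
  constructor
  · rw [Nat.one_le_iff_ne_zero, Ne, Finset.card_eq_zero, Finset.filter_eq_empty_iff]
    intro he
    have hs : StrictMono σ := Fin.strictMono_iff_lt_succ.2 fun l =>
      (not_lt.1 (he (Finset.mem_univ l))).lt_of_ne fun e =>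
        l.castSucc_lt_succ.ne (σ.injective e)
    exact h1.not_gt (hs hij)
  · by_contra hge
    have hu : (Finset.univ.filter fun i : Fin m => σ i.succ < σ i.castSucc) = Finset.univ :=
      (Finset.card_eq_iff_eq_univ _).1 (le_antisymm (Finset.card_le_univ _)
        (by rw [Fintype.card_fin]; omega))
    have hs : StrictAnti σ := Fin.strictAnti_iff_succ_lt.2 fun l =>
      Finset.filter_eq_self.1 hu l (Finset.mem_univ l)
    exact (h1.trans h2).not_gt (hs hjk)

theorem l213_eq_zero {m d : ℕ} (h : ¬ (1 ≤ d ∧ d < m)) : l213 (m + 1) d = 0 := by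
  rw [l213, Nat.card_eq_zero]
  exact Or.inl ⟨fun σ => h (σ.2.2.1 ▸ σ.2.1.descents_mem)⟩

theorem card_isOSP_not_leLt_eq_sum (m : ℕ) :
    Nat.card {p : Fin (m + 1) → Fin (m + 1) // IsOSP p ∧ ¬ LeLt p} =
      ∑ d ∈ Finset.range (m + 1), 2 ^ d * nar (m + 1) d := by
  rw [card_isOSP_not_leLt]
  simp only [and_comm (a := IsOSP _)]
  exact card_isOSP_eq_sum _ _ fun σ p h => not_congr h.contains213_iff_swappedLeLt

theorem card_isOSP_leLt_eq_sum (m : ℕ) :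
    Nat.card {p : Fin (m + 1) → Fin (m + 1) // IsOSP p ∧ LeLt p ∧ ¬ LeLt (Fin.init p)} =
      ∑ d ∈ Finset.Icc 1 (m + 1 - 2), 2 ^ d * l213 (m + 1) d := by
  rw [card_isOSP_leLt_not_init]
  simp only [and_comm (a := IsOSP _)]
  rw [card_isOSP_eq_sum (fun σ => Contains213 σ ∧ ReductionAvoids213 σ) _ fun σ p h =>
    and_congr h.contains213_iff_swappedLeLt h.reductionAvoids213_iff]
  have hl : ∀ d, Nat.card {σ : Equiv.Perm (Fin (m + 1)) //
      (Contains213 σ ∧ ReductionAvoids213 σ) ∧ descents σ = d} = l213 (m + 1) d := fun d =>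
    Nat.card_congr (Equiv.subtypeEquivRight fun σ => by tauto)
  simp only [hl]
  symm
  refine Finset.sum_subset (fun d hd => ?_) fun d _ hd => ?_
  · rw [Finset.mem_Icc] at hd
    rw [Finset.mem_range]
    omega
  · rw [Finset.mem_Icc] at hd
    rw [l213_eq_zero (by omega), mul_zero]

/-- Stopping condition `x_{i1} ≤ x_{i2} < x_{i3}` (`i1 < i2 < i3`): the number of
leaves after `n` steps equals
`Σ_{d=0}^{n-1} 2^d N_{n,d} + Σ_{j=3}^{n} Σ_{d=1}^{j-2} 2^d ℓ_{j,d}`. -/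
theorem woc_stop_lelt (n : ℕ) (hn : 1 ≤ n) :
    Nat.card {p : Fin n → Fin n // IsOSP p ∧ ¬ ChainLeLt p} +
      ∑ j ∈ Finset.Icc 1 n,
        Nat.card {p : Fin j → Fin j // IsOSP p ∧ ChainLeLt p ∧
          ¬ ∃ a b c : Fin j, a.val < j - 1 ∧ b.val < j - 1 ∧ c.val < j - 1 ∧
            a < b ∧ b < c ∧ p a ≤ p b ∧ p b < p c}
      = ∑ d ∈ Finset.range n, 2 ^ d * nar n d
        + ∑ j ∈ Finset.Icc 3 n, ∑ d ∈ Finset.Icc 1 (j - 2), 2 ^ d * l213 j d := by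
  obtain ⟨m, rfl⟩ := Nat.exists_eq_add_of_le' hn
  congr 1
  · exact card_isOSP_not_leLt_eq_sum m
  · have hterm : ∀ j ∈ Finset.Icc 1 (m + 1),
        Nat.card {p : Fin j → Fin j // IsOSP p ∧ ChainLeLt p ∧
          ¬ ∃ a b c : Fin j, a.val < j - 1 ∧ b.val < j - 1 ∧ c.val < j - 1 ∧
            a < b ∧ b < c ∧ p a ≤ p b ∧ p b < p c} =
          ∑ d ∈ Finset.Icc 1 (j - 2), 2 ^ d * l213 j d := by
      intro j hj
      obtain ⟨r, rfl⟩ := Nat.exists_eq_add_of_le' (Finset.mem_Icc.1 hj).1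
      rw [← card_isOSP_leLt_eq_sum r]
      simp only [leLt_init_iff]
      rfl
    rw [Finset.sum_congr rfl hterm]
    symm
    refine Finset.sum_subset (Finset.Icc_subset_Icc_left (by omega)) fun j hj hj' => ?_
    rw [Finset.mem_Icc] at hj hj'
    rw [Finset.Icc_eq_empty (by omega), Finset.sum_empty]
end

section
/- Fix an integer k > 1 and let w_n be the number of leaves after n steps of the restricted generating tree of weak-ordering chains with the k-equal stopping condition x_{i1} = x_{i2} = ⋯ = x_{ik}. Then w_n equals the n-th Fubini number for 1 ≤ n < k, and for n ≥ k, w_n = Σ_{i=1}^{k−1} binom(n,i) · a_{n−i} + Σ_{j=k}^{n} binom(j−1, k−1) · Σ_{i=0}^{j−k} binom(j−k, i) · a_i · a_{j−k−i}, where a_m is the number of ordered set partitions of [m] all of whose blocks have size at most k − 1 (a_0 = 1). -/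
/-- All blocks of the ordered set partition encoded by `p` have size at most `k - 1`. -/
noncomputable def BlocksAtMostCard {n : ℕ} (k : ℕ) (p : Fin n → Fin n) : Prop :=
  ∀ v : Fin n, Nat.card {i : Fin n // p i = v} ≤ k - 1

/-- `aK k n` is the number of ordered set partitions of `[n]` all of whose blocks
have size at most `k - 1`. -/
noncomputable def aK (k n : ℕ) : ℕ :=
  Nat.card {p : Fin n → Fin n // IsOSP p ∧ BlocksAtMostCard k p}

/-- The `n`-th Fubini number: the total number of ordered set partitions of `[n]`. -/
noncomputable def fubini (n : ℕ) : ℕ :=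
  Nat.card {p : Fin n → Fin n // IsOSP p}

/-- The ordered set partition encoded by `p` contains the `k`-equal condition
`x_{i1} = ⋯ = x_{ik}`: some block has at least `k` elements. -/
def ContainsKEq {n : ℕ} (k : ℕ) (p : Fin n → Fin n) : Prop :=
  ∃ f : Fin k → Fin n, Function.Injective f ∧ ∀ s t, p (f s) = p (f t)

/-- The restriction to `[m]` of the ordered set partition encoded by `p` contains the
`k`-equal condition: some block has at least `k` elements of `[m]`. -/
def ContainsKEqWithin {n : ℕ} (k m : ℕ) (p : Fin n → Fin n) : Prop :=
  ∃ f : Fin k → Fin n, Function.Injective f ∧ (∀ s, (f s).val < m) ∧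
    ∀ s t, p (f s) = p (f t)
section BlockDecomposition

open Finset

/-- The fiber of `p` over `v`, that is, the block of index `v`. -/
def blockAt {α : Type*} [Fintype α] (p : α → ℕ) (v : ℕ) : Finset α := univ.filter fun i => p i = v

theorem mem_blockAt {α : Type*} [Fintype α] {p : α → ℕ} {v : ℕ} {i : α} :
    i ∈ blockAt p v ↔ p i = v := by
  simp [blockAt]

theorem card_blockAt_le_of_injective {α β : Type*} [Fintype α] [Fintype β] {p : α → ℕ}
    {q : β → ℕ} {v w : ℕ} {f : β → α} (hf : f.Injective) (h : ∀ b, q b = w → p (f b) = v) :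
    #(blockAt q w) ≤ #(blockAt p v) :=
  card_le_card_of_injOn f (fun b hb => by
    simp only [mem_coe, mem_blockAt] at hb ⊢; exact h b hb) hf.injOn

theorem card_blockAt_le_of_exists {α β : Type*} [Fintype α] [Fintype β] {p : α → ℕ}
    {q : β → ℕ} {v w : ℕ} (f : β → α) (h : ∀ a, p a = v → ∃ b, f b = a ∧ q b = w) :
    #(blockAt p v) ≤ #(blockAt q w) :=
  card_le_card_of_surjOn f (fun a ha => by
    simp only [mem_coe, mem_blockAt] at ha
    obtain ⟨b, hb, hq⟩ := h a ha
    exact ⟨b, by simpa [mem_blockAt] using hq, hb⟩)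

open Classical in
/-- Ordered set partitions of a finite type, encoded by `ℕ`-valued block indices. -/
noncomputable def ospFinset (α : Type*) [Fintype α] : Finset (α → ℕ) :=
  (Fintype.piFinset fun _ => range (Fintype.card α)).filter fun p => IsLowerSet (Set.range p)

theorem mem_range_iff_lt_card_image {α : Type*} [Fintype α] {p : α → ℕ}
    (hp : IsLowerSet (Set.range p)) (w : ℕ) : w ∈ Set.range p ↔ w < #(univ.image p) := by
  constructor
  · intro hw
    have h : range (w + 1) ⊆ univ.image p := by
      intro u hu
      have := hp (show u ≤ w by simpa [Nat.lt_succ_iff] using hu) hw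
      simpa using this
    simpa using card_le_card h
  · intro hw
    by_contra hn
    have h : univ.image p ⊆ range w := by
      intro u hu
      rw [mem_range]
      by_contra hle
      exact hn (hp (not_lt.mp hle) (by simpa using hu))
    have := card_le_card h
    simp only [card_range] at this
    omega

theorem mem_ospFinset {α : Type*} [Fintype α] {p : α → ℕ} :
    p ∈ ospFinset α ↔ IsLowerSet (Set.range p) := by
  simp only [ospFinset, mem_filter, Fintype.mem_piFinset, mem_range, and_iff_right_iff_imp]
  intro hp i
  exact ((mem_range_iff_lt_card_image hp _).1 ⟨i, rfl⟩).trans_le card_image_le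

open Classical in
/-- Ordered set partitions of a finite type all of whose blocks have fewer than `k` elements. -/
noncomputable def smallOspFinset (k : ℕ) (α : Type*) [Fintype α] : Finset (α → ℕ) :=
  (ospFinset α).filter fun p => ∀ v, #(blockAt p v) < k

theorem mem_smallOspFinset {α : Type*} [Fintype α] {k : ℕ} {p : α → ℕ} :
    p ∈ smallOspFinset k α ↔ IsLowerSet (Set.range p) ∧ ∀ v, #(blockAt p v) < k := by
  simp only [smallOspFinset, mem_filter, mem_ospFinset]

open Classical in
theorem natCard_isOSP_eq_card_filter {α : Type*} [Fintype α] {n : ℕ} (e : Fin n ≃ α)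
    (P : (Fin n → Fin n) → Prop) (Q : (α → ℕ) → Prop)
    (hPQ : ∀ p : Fin n → Fin n, P p ↔ Q fun a => p (e.symm a)) :
    Nat.card {p : Fin n → Fin n // IsOSP p ∧ P p} = #((ospFinset α).filter Q) := by
  have hn : n = Fintype.card α := by simpa using Fintype.card_congr e
  rw [Nat.card_eq_fintype_card, Fintype.card_subtype]
  refine card_bij (fun p _ a => (p (e.symm a) : ℕ)) ?_ ?_ ?_
  · intro p hp
    simp only [mem_filter, mem_univ, true_and, mem_ospFinset] at hp ⊢
    refine ⟨?_, (hPQ p).1 hp.2⟩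
    rintro _ b hb ⟨i, rfl⟩
    have hb' : b ≤ p (e.symm i) := hb
    obtain ⟨j, hj⟩ := hp.1 (e.symm i) ⟨b, by omega⟩ (Fin.le_def.2 hb')
    exact ⟨e j, by simp [hj]⟩
  · intro p _ q _ h
    funext i
    exact Fin.ext (by simpa using congrFun h (e i))
  · intro q hq
    simp only [mem_filter, mem_ospFinset] at hq
    have hlt (a : α) : q a < n := by
      rw [hn]
      exact ((mem_range_iff_lt_card_image hq.1 _).1 ⟨a, rfl⟩).trans_le card_image_le
    refine ⟨fun i => ⟨q (e i), hlt _⟩, ?_, by simp⟩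
    simp only [mem_filter, mem_univ, true_and]
    refine ⟨?_, (hPQ _).2 (by simpa using hq.2)⟩
    intro i v hv
    obtain ⟨a, ha⟩ := hq.1 (Fin.le_def.1 hv) ⟨e i, rfl⟩
    exact ⟨e.symm a, Fin.ext (by simpa using ha)⟩

/-- Place an ordered set partition of `L` before the block `B` and one of `(L ∪ B)ᶜ` after it. -/
def glueAround {α : Type*} [Fintype α] [DecidableEq α] (L B : Finset α) (q : L → ℕ)
    (r : ((L ∪ B)ᶜ : Finset α) → ℕ) (i : α) : ℕ :=
  if hL : i ∈ L then q ⟨i, hL⟩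
  else if hB : i ∈ B then #(univ.image q)
  else #(univ.image q) + 1 + r ⟨i, by simp [hL, hB]⟩

open Classical in
/-- Ordered set partitions having `B` as a block and `L` as the union of the preceding blocks. -/
theorem card_filter_block_eq {α : Type*} [Fintype α] [DecidableEq α] {k : ℕ} (hk : 0 < k)
    {L B : Finset α} (hB : B.Nonempty) (hd : Disjoint L B) :
    #((ospFinset α).filter fun p => ∃ v, (∀ i, p i < v ↔ i ∈ L) ∧ (∀ i, p i = v ↔ i ∈ B) ∧
        ∀ w, w ≠ v → #(blockAt p w) < k) =
      #(smallOspFinset k L) * #(smallOspFinset k ((L ∪ B)ᶜ : Finset α)) := by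
  have hnot {i : α} (h : i ∈ B) : i ∉ L := fun h' => disjoint_left.1 hd h' h
  rw [← card_product]
  symm
  refine card_bij (fun x _ => glueAround L B x.1 x.2) ?_ ?_ ?_
  · rintro ⟨q, r⟩ hx
    simp only [mem_product, mem_smallOspFinset] at hx
    obtain ⟨⟨hq, hqk⟩, hr, hrk⟩ := hx
    have hqm (i : L) : q i < #(univ.image q) := (mem_range_iff_lt_card_image hq _).1 ⟨i, rfl⟩
    have gL (i : L) : glueAround L B q r i = q i := by simp [glueAround]
    have gB (i : α) (hi : i ∈ B) : glueAround L B q r i = #(univ.image q) := by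
      simp [glueAround, hi, hnot hi]
    have gR (i : ((L ∪ B)ᶜ : Finset α)) :
        glueAround L B q r i = #(univ.image q) + 1 + r i := by
      have hi := i.2
      simp only [mem_compl, mem_union, not_or] at hi
      simp [glueAround, hi]
    have hcases (i : α) : i ∈ L ∨ i ∈ B ∨ i ∈ (L ∪ B)ᶜ := by
      simp only [mem_compl, mem_union]; tauto
    simp only [mem_filter, mem_ospFinset]
    obtain ⟨b₀, hb₀⟩ := hB
    have hrange := mem_range_iff_lt_card_image hq
    generalize glueAround L B q r = g at gL gB gR
    generalize #(univ.image q) = m at *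
    refine ⟨?_, m, fun i => ⟨fun h => ?_, fun h => ?_⟩, fun i => ⟨fun h => ?_, gB i⟩, fun w hw => ?_⟩
    · rintro _ b hb ⟨i, rfl⟩
      rcases lt_trichotomy b m with h | rfl | h
      · obtain ⟨j, rfl⟩ := (hrange b).2 h
        exact ⟨j, gL j⟩
      · exact ⟨b₀, gB _ hb₀⟩
      · rcases hcases i with hi | hi | hi
        · have := gL ⟨i, hi⟩
          have := hqm ⟨i, hi⟩
          simp only at *
          omega
        · have := gB i hi
          omega
        · have hgi := gR ⟨i, hi⟩
          obtain ⟨j, hj⟩ := hr (show b - (m + 1) ≤ r ⟨i, hi⟩ by simp only at *; omega) ⟨_, rfl⟩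
          exact ⟨j, by rw [gR, hj]; omega⟩
    · rcases hcases i with hi | hi | hi
      · exact hi
      · have := gB i hi
        omega
      · have := gR ⟨i, hi⟩
        simp only at *
        omega
    · exact (gL ⟨i, h⟩).trans_lt (hqm _)
    · rcases hcases i with hi | hi | hi
      · have := gL ⟨i, hi⟩
        have := hqm ⟨i, hi⟩
        simp only at *
        omega
      · exact hi
      · have := gR ⟨i, hi⟩
        simp only at *
        omega
    · rcases lt_or_gt_of_ne hw with h | h
      · refine (card_blockAt_le_of_exists (Subtype.val : L → α) fun i hiw => ?_).trans_lt (hqk w)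
        rcases hcases i with hi | hi | hi
        · exact ⟨⟨i, hi⟩, rfl, by rw [← gL]; exact hiw⟩
        · have := gB i hi
          omega
        · have := gR ⟨i, hi⟩
          simp only at *
          omega
      · refine (card_blockAt_le_of_exists (Subtype.val : ((L ∪ B)ᶜ : Finset α) → α)
          fun i hiw => ?_).trans_lt (hrk (w - (m + 1)))
        rcases hcases i with hi | hi | hi
        · have := gL ⟨i, hi⟩
          have := hqm ⟨i, hi⟩
          simp only at *
          omega
        · have := gB i hi
          omega
        · have := gR ⟨i, hi⟩
          exact ⟨⟨i, hi⟩, rfl, by simp only at *; omega⟩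
  · rintro ⟨q, r⟩ _ ⟨q', r'⟩ _ h
    simp only at h
    have hqq : q = q' := by
      funext i
      simpa [glueAround] using congrFun h i
    subst hqq
    congr 1
    funext i
    have hi := i.2
    simp only [mem_compl, mem_union, not_or] at hi
    simpa [glueAround, hi] using congrFun h i
  · intro p hp
    simp only [mem_filter, mem_ospFinset] at hp
    obtain ⟨hp, v, hpL, hpB, hpk⟩ := hp
    obtain ⟨b₀, hb₀⟩ := hB
    have hv : v ∈ Set.range p := ⟨b₀, (hpB _).2 hb₀⟩
    have hgt (i : α) : i ∈ (L ∪ B)ᶜ ↔ v < p i := by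
      rw [mem_compl, mem_union, ← hpL, ← hpB]
      omega
    have himage : univ.image (fun i : L => p i) = range v := by
      ext w
      simp only [mem_image, mem_univ, true_and, mem_range, Subtype.exists, exists_prop]
      constructor
      · rintro ⟨i, hi, rfl⟩
        exact (hpL i).2 hi
      · intro hw
        obtain ⟨i, rfl⟩ := hp hw.le hv
        exact ⟨i, (hpL i).1 hw, rfl⟩
    refine ⟨(fun i => p i, fun i => p i - (v + 1)), ?_, ?_⟩
    · simp only [mem_product, mem_smallOspFinset]
      refine ⟨⟨?_, fun w => ?_⟩, ?_, fun w => ?_⟩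
      · rintro _ b hb ⟨i, rfl⟩
        obtain ⟨j, rfl⟩ := hp hb ⟨i, rfl⟩
        exact ⟨⟨j, (hpL j).1 (lt_of_le_of_lt hb ((hpL i).2 i.2))⟩, rfl⟩
      · by_cases hw : w = v
        · have : blockAt (fun i : L => p i) w = ∅ := by
            ext i
            have := (hpL i).2 i.2
            simp only [mem_blockAt, notMem_empty, iff_false]
            omega
          rwa [this, card_empty]
        · exact (card_blockAt_le_of_injective Subtype.val_injective fun _ h => h).trans_lt
            (hpk w hw)
      · rintro _ b hb ⟨i, rfl⟩
        have hi := (hgt i).1 i.2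
        simp only at hb
        obtain ⟨j, hj⟩ := hp (show b + (v + 1) ≤ p i by omega) ⟨i, rfl⟩
        exact ⟨⟨j, (hgt j).2 (by omega)⟩, by simp only; omega⟩
      · refine (card_blockAt_le_of_injective Subtype.val_injective fun i h => ?_).trans_lt
          (hpk (w + (v + 1)) (by omega))
        have hi := (hgt i).1 i.2
        omega
    · funext i
      unfold glueAround
      rw [himage, card_range]
      have hL := hpL i
      have hB := hpB i
      split_ifs with h h'
      · rfl
      · exact (hB.2 h').symm
      · simp only [← hL, ← hB] at h h'
        simp only
        omega

open Classical in
theorem card_smallOspFinset {α : Type*} [Fintype α] {k : ℕ} (hk : 0 < k) :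
    #(smallOspFinset k α) = aK k (Fintype.card α) := by
  let e := (Fintype.equivFin α).symm
  rw [aK, natCard_isOSP_eq_card_filter e _ fun p => ∀ v, #(blockAt p v) < k]
  · simp only [smallOspFinset]
  intro p
  have key (v : Fin (Fintype.card α)) :
      #(blockAt (fun a => (p (e.symm a) : ℕ)) v) = Nat.card {i // p i = v} := by
    rw [Nat.card_eq_fintype_card, Fintype.card_subtype]
    refine card_bij' (fun a _ => e.symm a) (fun i _ => e i) ?_ ?_ ?_ ?_ <;>
      simp [mem_blockAt, Fin.ext_iff]
  constructor
  · intro h v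
    by_cases hv : v < Fintype.card α
    · have := h ⟨v, hv⟩
      rw [← key] at this
      simp only at this
      omega
    · have : blockAt (fun a => (p (e.symm a) : ℕ)) v = ∅ := by
        ext a
        have := (p (e.symm a)).isLt
        simp only [mem_blockAt, notMem_empty, iff_false]
        omega
      rwa [this, card_empty]
  · intro h v
    have := h v
    rw [key] at this
    omega

theorem aK_zero (k : ℕ) : aK k 0 = 1 := by
  rw [aK, Nat.card_eq_one_iff_unique]
  exact ⟨⟨fun p q => Subtype.ext (Subsingleton.elim _ _)⟩,
    ⟨⟨fun i => i, fun i => i.elim0, fun v => v.elim0⟩⟩⟩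

open Classical in
theorem aK_eq_sum_choose {k n : ℕ} (hk : 0 < k) (hn : 0 < n) :
    aK k n = ∑ i ∈ Icc 1 (k - 1), n.choose i * aK k (n - i) := by
  have zero_mem {p : Fin n → ℕ} (hp : IsLowerSet (Set.range p)) : ∃ i, p i = 0 :=
    hp (Nat.zero_le _) ⟨⟨0, hn⟩, rfl⟩
  have hcard : #(smallOspFinset k (Fin n)) = aK k n := by
    rw [card_smallOspFinset hk, Fintype.card_fin]
  rw [← hcard, card_eq_sum_card_fiberwise (f := fun p => #(blockAt p 0)) (t := Icc 1 (k - 1))]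
  · refine sum_congr rfl fun i hi => ?_
    rw [mem_Icc] at hi
    rw [card_eq_sum_card_fiberwise (f := fun p => blockAt p 0) (t := powersetCard i univ)]
    · rw [sum_congr rfl fun B hB => ?_, sum_const, card_powersetCard, card_univ,
        Fintype.card_fin, smul_eq_mul]
      rw [mem_powersetCard_univ] at hB
      have hB' : B.Nonempty := card_pos.1 (by omega)
      have h := card_filter_block_eq hk hB' (disjoint_empty_left B)
      rw [card_smallOspFinset hk, card_smallOspFinset hk, Fintype.card_coe, Fintype.card_coe,
        card_empty, aK_zero, one_mul, empty_union, card_compl, Fintype.card_fin, hB] at h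
      rw [← h]
      congr 1
      ext p
      simp only [mem_filter, mem_smallOspFinset, mem_ospFinset, notMem_empty, iff_false, not_lt]
      constructor
      · rintro ⟨⟨⟨hp, hpk⟩, -⟩, rfl⟩
        exact ⟨hp, 0, fun i => Nat.zero_le _, fun i => mem_blockAt.symm, fun w _ => hpk w⟩
      · rintro ⟨hp, v, hv, hpB, hpk⟩
        obtain ⟨j, hj⟩ := zero_mem hp
        obtain rfl : v = 0 := by
          have := hv j
          omega
        have hb : blockAt p 0 = B := by
          ext i
          rw [mem_blockAt, hpB]
        refine ⟨⟨⟨hp, fun w => ?_⟩, by rw [hb, hB]⟩, hb⟩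
        by_cases hw : w = 0
        · rw [hw, hb, hB]
          omega
        · exact hpk w hw
    · intro p hp
      simpa [mem_powersetCard_univ] using (mem_filter.1 (mem_coe.1 hp)).2
  · intro p hp
    rw [mem_coe, mem_smallOspFinset] at hp
    obtain ⟨j, hj⟩ := zero_mem hp.1
    have h1 : 0 < #(blockAt p 0) := card_pos.2 ⟨j, mem_blockAt.2 hj⟩
    have h2 := hp.2 0
    simp only [coe_Icc, Set.mem_Icc]
    omega

theorem containsKEqWithin_iff {k m n : ℕ} (hk : 0 < k) (p : Fin n → Fin n) :
    ContainsKEqWithin k m p ↔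
      ∃ v, k ≤ #((blockAt (fun i => (p i : ℕ)) v).filter fun i => i.val < m) := by
  constructor
  · rintro ⟨f, hf, hm, hp⟩
    refine ⟨p (f ⟨0, hk⟩), ?_⟩
    have := card_le_card_of_injOn (s := univ) f (t := (blockAt (fun i => (p i : ℕ))
      (p (f ⟨0, hk⟩))).filter fun i => i.val < m) (fun s _ => ?_) hf.injOn
    · simpa using this
    · simp [mem_blockAt, hm s, hp s ⟨0, hk⟩]
  · rintro ⟨v, hv⟩
    have hmem := orderEmbOfCardLe_mem _ hv
    simp only [mem_filter, mem_blockAt] at hmem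
    exact ⟨orderEmbOfCardLe _ hv, (orderEmbOfCardLe _ hv).injective, fun s => (hmem s).2,
      fun s t => Fin.ext ((hmem s).1.trans (hmem t).1.symm)⟩

theorem containsKEq_iff {k n : ℕ} (hk : 0 < k) (p : Fin n → Fin n) :
    ContainsKEq k p ↔ ∃ v, k ≤ #(blockAt (fun i => (p i : ℕ)) v) := by
  have h : ContainsKEq k p ↔ ContainsKEqWithin k n p := by
    simp [ContainsKEq, ContainsKEqWithin]
  simp [h, containsKEqWithin_iff hk]

open Classical in
theorem natCard_not_containsKEq {k : ℕ} (hk : 0 < k) (n : ℕ) :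
    Nat.card {p : Fin n → Fin n // IsOSP p ∧ ¬ ContainsKEq k p} = aK k n := by
  have hcard : #(smallOspFinset k (Fin n)) = aK k n := by
    rw [card_smallOspFinset hk, Fintype.card_fin]
  rw [← hcard, natCard_isOSP_eq_card_filter (Equiv.refl _) _ fun p => ∀ v, #(blockAt p v) < k]
  · simp only [smallOspFinset]
  · simp [containsKEq_iff hk]

theorem containsKEq_and_not_within_iff {k j : ℕ} (hk : 0 < k) (p : Fin (j + 1) → Fin (j + 1)) :
    (ContainsKEq k p ∧ ¬ ContainsKEqWithin k j p) ↔
      #(blockAt (fun i => (p i : ℕ)) (p (Fin.last j))) = k ∧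
        ∀ w, w ≠ (p (Fin.last j) : ℕ) → #(blockAt (fun i => (p i : ℕ)) w) < k := by
  rw [containsKEq_iff hk, containsKEqWithin_iff hk]
  push Not
  have hfilter (v : ℕ) : (blockAt (fun i => (p i : ℕ)) v).filter (fun i => i.val < j) =
      (blockAt (fun i => (p i : ℕ)) v).erase (Fin.last j) := by
    ext i
    simp only [mem_filter, mem_erase, ne_eq, Fin.ext_iff, Fin.val_last]
    have := i.isLt
    constructor
    · rintro ⟨h, h'⟩
      exact ⟨by omega, h⟩
    · rintro ⟨h, h'⟩
      exact ⟨h', by omega⟩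
  simp only [hfilter]
  have hlast : Fin.last j ∈ blockAt (fun i => (p i : ℕ)) (p (Fin.last j)) := mem_blockAt.2 rfl
  have hother {w : ℕ} (hw : w ≠ (p (Fin.last j) : ℕ)) :
      (blockAt (fun i => (p i : ℕ)) w).erase (Fin.last j) = blockAt (fun i => (p i : ℕ)) w :=
    erase_eq_of_notMem fun h => hw (mem_blockAt.1 h).symm
  constructor
  · rintro ⟨⟨v, hv⟩, h⟩
    have hw (w : ℕ) (hw : w ≠ (p (Fin.last j) : ℕ)) :
        #(blockAt (fun i => (p i : ℕ)) w) < k := by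
      rw [← hother hw]
      exact h w
    refine ⟨?_, hw⟩
    have h1 := h (p (Fin.last j))
    rw [card_erase_of_mem hlast] at h1
    obtain rfl : v = p (Fin.last j) := by
      by_contra hne
      have := hw v hne
      omega
    omega
  · rintro ⟨h, h'⟩
    refine ⟨⟨_, h.ge⟩, fun v => ?_⟩
    by_cases hv : v = p (Fin.last j)
    · rw [hv, card_erase_of_mem hlast, h]
      omega
    · rw [hother hv]
      exact h' v hv

theorem card_powersetCard_filter_mem {α : Type*} [Fintype α] [DecidableEq α] (x : α) (k : ℕ) :
    #((powersetCard (k + 1) (univ : Finset α)).filter (x ∈ ·)) =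
      (Fintype.card α - 1).choose k := by
  have h : #(powersetCard k (univ.erase x)) = (Fintype.card α - 1).choose k := by
    rw [card_powersetCard, card_erase_of_mem (mem_univ x), card_univ]
  rw [← h]
  refine card_bij' (fun B _ => B.erase x) (fun B _ => insert x B) ?_ ?_ ?_ ?_
  · intro B hB
    simp only [mem_filter, mem_powersetCard_univ] at hB
    simp [mem_powersetCard, card_erase_of_mem hB.2, hB.1, erase_subset_erase]
  · intro B hB
    simp only [mem_powersetCard, subset_erase, subset_univ, true_and] at hB
    simp [card_insert_of_notMem hB.1, hB.2]
  · intro B hB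
    exact insert_erase (mem_filter.1 hB).2
  · intro B hB
    simp only [mem_powersetCard, subset_erase, subset_univ, true_and] at hB
    exact erase_insert hB.1

open Classical in
theorem natCard_containsKEq_not_within {k j : ℕ} (hk : 0 < k) (hj : 0 < j) :
    Nat.card {p : Fin j → Fin j // IsOSP p ∧ ContainsKEq k p ∧ ¬ ContainsKEqWithin k (j - 1) p} =
      (j - 1).choose (k - 1) * ∑ i ∈ range (j - k + 1),
        (j - k).choose i * aK k i * aK k (j - k - i) := by
  obtain ⟨j, rfl⟩ := Nat.exists_eq_succ_of_ne_zero hj.ne'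
  simp only [Nat.succ_eq_add_one, Nat.add_sub_cancel]
  let x := Fin.last j
  rw [natCard_isOSP_eq_card_filter (Equiv.refl _) _ (fun p => #(blockAt p (p x)) = k ∧
    ∀ w, w ≠ p x → #(blockAt p w) < k) (fun p => containsKEq_and_not_within_iff hk p)]
  rw [card_eq_sum_card_fiberwise (f := fun p => blockAt p (p x))
    (t := (powersetCard k univ).filter (x ∈ ·))]
  · have hnum : #((powersetCard k (univ : Finset (Fin (j + 1)))).filter (x ∈ ·)) =
        j.choose (k - 1) := by
      have h := card_powersetCard_filter_mem x (k - 1)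
      rwa [Nat.sub_add_cancel hk, Fintype.card_fin, Nat.add_sub_cancel] at h
    rw [← hnum, ← smul_eq_mul, ← sum_const]
    refine sum_congr rfl fun B hB => ?_
    rw [mem_filter, mem_powersetCard_univ] at hB
    obtain ⟨hBk, hxB⟩ := hB
    have hBc : #Bᶜ = j + 1 - k := by rw [card_compl, Fintype.card_fin, hBk]
    rw [card_eq_sum_card_fiberwise (f := fun p => univ.filter fun i => p i < p x)
      (t := Bᶜ.powerset)]
    · have hsum := sum_powerset_apply_card (fun i => aK k i * aK k (j + 1 - k - i)) (x := Bᶜ)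
      simp only [hBc, smul_eq_mul, ← mul_assoc] at hsum
      rw [← hsum]
      refine sum_congr rfl fun L hL => ?_
      have hd : Disjoint L B := by
        rw [mem_powerset] at hL
        exact disjoint_of_subset_left hL disjoint_compl_left
      have h := card_filter_block_eq hk ⟨x, hxB⟩ hd
      rw [card_smallOspFinset hk, card_smallOspFinset hk, Fintype.card_coe, Fintype.card_coe,
        card_compl, card_union_of_disjoint hd, Fintype.card_fin, hBk, add_comm #L,
        ← Nat.sub_sub] at h
      rw [← h]
      congr 1
      ext p
      simp only [mem_filter, mem_ospFinset]
      constructor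
      · rintro ⟨⟨⟨hp, -, hpk⟩, rfl⟩, rfl⟩
        exact ⟨hp, p x, fun i => by simp, fun i => mem_blockAt.symm, hpk⟩
      · rintro ⟨hp, v, hpL, hpB, hpk⟩
        obtain rfl : p x = v := (hpB x).2 hxB
        have hb : blockAt p (p x) = B := by
          ext i
          rw [mem_blockAt, hpB]
        refine ⟨⟨⟨hp, by rw [hb, hBk], hpk⟩, hb⟩, ?_⟩
        ext i
        simp [hpL]
    · intro p hp
      simp only [coe_filter, mem_filter, Set.mem_ofPred_eq] at hp
      obtain ⟨-, rfl⟩ := hp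
      simp only [mem_coe, mem_powerset]
      intro i hi
      simp only [mem_filter, mem_univ, true_and] at hi
      simp only [mem_compl, mem_blockAt]
      omega
  · intro p hp
    simp only [coe_filter, Set.mem_ofPred_eq] at hp
    simp [hp.2.1, mem_blockAt]

theorem not_containsKEq_of_lt {k n : ℕ} (h : n < k) (p : Fin n → Fin n) : ¬ ContainsKEq k p := by
  rintro ⟨f, hf, -⟩
  have := Fintype.card_le_of_injective f hf
  simp only [Fintype.card_fin] at this
  omega

theorem natCard_containsKEq_not_within_of_lt {k j : ℕ} (h : j < k) :
    Nat.card {p : Fin j → Fin j // IsOSP p ∧ ContainsKEq k p ∧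
      ¬ ContainsKEqWithin k (j - 1) p} = 0 := by
  simp [not_containsKEq_of_lt h]

end BlockDecomposition

/-- Stopping condition `x_{i1} = ⋯ = x_{ik}` (`k > 1`): the number of leaves after
`n` steps equals the Fubini number `f_n` for `1 ≤ n < k`, and for `n ≥ k` it equals
`Σ_{i=1}^{k-1} binom(n,i) a_{n-i}
  + Σ_{j=k}^{n} binom(j-1,k-1) Σ_{i=0}^{j-k} binom(j-k,i) a_i a_{j-k-i}`. -/
theorem woc_stop_kEqual (k : ℕ) (hk : 1 < k) :
    (∀ n, 1 ≤ n → n < k →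
      Nat.card {p : Fin n → Fin n // IsOSP p ∧ ¬ ContainsKEq k p} +
        ∑ j ∈ Finset.Icc 1 n,
          Nat.card {p : Fin j → Fin j // IsOSP p ∧ ContainsKEq k p ∧
            ¬ ContainsKEqWithin k (j - 1) p}
        = fubini n) ∧
    (∀ n, k ≤ n →
      Nat.card {p : Fin n → Fin n // IsOSP p ∧ ¬ ContainsKEq k p} +
        ∑ j ∈ Finset.Icc 1 n,
          Nat.card {p : Fin j → Fin j // IsOSP p ∧ ContainsKEq k p ∧
            ¬ ContainsKEqWithin k (j - 1) p}
        = ∑ i ∈ Finset.Icc 1 (k - 1), n.choose i * aK k (n - i)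
          + ∑ j ∈ Finset.Icc k n, (j - 1).choose (k - 1) *
              ∑ i ∈ Finset.range (j - k + 1),
                (j - k).choose i * aK k i * aK k (j - k - i)) := by
  constructor
  · intro n _ hn
    rw [Finset.sum_eq_zero fun j hj => natCard_containsKEq_not_within_of_lt
      ((Finset.mem_Icc.1 hj).2.trans_lt hn)]
    simp [not_containsKEq_of_lt hn, fubini]
  · intro n hn
    have hk0 : 0 < k := by omega
    rw [natCard_not_containsKEq hk0, aK_eq_sum_choose hk0 (by omega)]
    congr 1
    rw [← Finset.sum_subset (Finset.Icc_subset_Icc_left hk0)]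
    · refine Finset.sum_congr rfl fun j hj => ?_
      exact natCard_containsKEq_not_within hk0 (by have := (Finset.mem_Icc.1 hj).1; omega)
    · intro j hj hj'
      refine natCard_containsKEq_not_within_of_lt ?_
      simp only [Finset.mem_Icc] at hj hj'
      omega
end

section
/- For every n ≥ 1, the number of ordered set partitions of [n] that avoid the condition x_{i1} < x_{i2} = x_{i3} (i.e., there are no indices i1 < i2 < i3 with pos(i1) < pos(i2) = pos(i3)) equals (n+1)!/2. -/
/-- The ordered set partition encoded by `p` contains the condition
`x_{i1} < x_{i2} = x_{i3}` with `i1 < i2 < i3`. -/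
def ChainLtEq {n : ℕ} (p : Fin n → Fin n) : Prop :=
  ∃ i j k : Fin n, i < j ∧ j < k ∧ p i < p j ∧ p j = p k

/-- `p : Fin n → ℕ` encodes an ordered set partition (its values form an initial segment of `ℕ`)
avoiding the condition `x_{i1} < x_{i2} = x_{i3}`. -/
def IsAvoider {n : ℕ} (p : Fin n → ℕ) : Prop :=
  (∀ i v, v ≤ p i → ∃ j, p j = v) ∧ ∀ i j k, i < j → j < k → p i < p j → p j ≠ p k

/-- The number of blocks of an ordered set partition encoded by `p`. -/
def numBlocks {n : ℕ} (p : Fin n → ℕ) : ℕ :=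
  Finset.univ.sup fun i => p i + 1

theorem lt_numBlocks {n : ℕ} (p : Fin n → ℕ) (i : Fin n) : p i < numBlocks p :=
  Finset.le_sup (f := fun i => p i + 1) (Finset.mem_univ i)

theorem numBlocks_eq_of_forall_le {n : ℕ} {p : Fin n → ℕ} {x : Fin n}
    (h : ∀ i, p i ≤ p x) : numBlocks p = p x + 1 :=
  le_antisymm (Finset.sup_le fun i _ => Nat.succ_le_succ (h i)) (lt_numBlocks p x)

theorem exists_forall_le_apply {n : ℕ} (p : Fin (n + 1) → ℕ) : ∃ x, ∀ i, p i ≤ p x :=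
  Finite.exists_max p

namespace IsAvoider

theorem exists_eq_of_lt_numBlocks {n : ℕ} {p : Fin n → ℕ} (hp : IsAvoider p) {v : ℕ}
    (hv : v < numBlocks p) : ∃ j, p j = v := by
  obtain ⟨i, -, hi⟩ := Finset.lt_sup_iff.1 hv
  exact hp.1 i v (Nat.lt_succ_iff.1 hi)

theorem apply_lt {n : ℕ} {p : Fin n → ℕ} (hp : IsAvoider p) (i : Fin n) : p i < n := by
  have hsub : Finset.range (p i + 1) ⊆ Finset.univ.image p := by
    intro v hv
    obtain ⟨j, hj⟩ := hp.1 i v (Nat.lt_succ_iff.1 (Finset.mem_range.1 hv))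
    exact Finset.mem_image.2 ⟨j, Finset.mem_univ j, hj⟩
  have h := (Finset.card_le_card hsub).trans Finset.card_image_le
  simpa using h

theorem insertNth {n : ℕ} {p : Fin n → ℕ} (hp : IsAvoider p) (x : Fin (n + 1)) :
    IsAvoider (x.insertNth (α := fun _ => ℕ) (numBlocks p) p) := by
  constructor
  · intro i v hv
    have hv' : v ≤ numBlocks p := by
      rcases Fin.eq_self_or_eq_succAbove x i with rfl | ⟨i, rfl⟩
      · simpa using hv
      · have := lt_numBlocks p i
        simp at hv
        omega
    rcases hv'.eq_or_lt with rfl | hlt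
    · exact ⟨x, by simp⟩
    · obtain ⟨j, hj⟩ := hp.exists_eq_of_lt_numBlocks hlt
      exact ⟨x.succAbove j, by simpa using hj⟩
  · intro i j k hij hjk hlt heq
    rcases Fin.eq_self_or_eq_succAbove x j with rfl | ⟨j, rfl⟩
    · rcases Fin.eq_self_or_eq_succAbove j k with rfl | ⟨k, rfl⟩
      · exact lt_irrefl _ hjk
      · simp only [Fin.insertNth_apply_same, Fin.insertNth_apply_succAbove] at heq
        exact (lt_numBlocks p k).ne' heq
    · rcases Fin.eq_self_or_eq_succAbove x k with rfl | ⟨k, rfl⟩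
      · simp only [Fin.insertNth_apply_same, Fin.insertNth_apply_succAbove] at heq
        exact (lt_numBlocks p j).ne heq
      · rcases Fin.eq_self_or_eq_succAbove x i with rfl | ⟨i, rfl⟩
        · simp only [Fin.insertNth_apply_same, Fin.insertNth_apply_succAbove] at hlt
          exact (lt_numBlocks p j).not_gt hlt
        · simp only [Fin.insertNth_apply_succAbove] at hlt heq
          exact hp.2 i j k (Fin.succAbove_lt_succAbove_iff.1 hij)
            (Fin.succAbove_lt_succAbove_iff.1 hjk) hlt heq

theorem cons {n : ℕ} {p : Fin n → ℕ} (hp : IsAvoider p) {x : Fin n} (hx : ∀ i, p i ≤ p x) :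
    IsAvoider (Fin.cons (α := fun _ => ℕ) (p x) p) := by
  constructor
  · intro i v hv
    have hv' : v ≤ p x := by
      cases i using Fin.cases with
      | zero => simpa using hv
      | succ i => exact le_trans (by simpa using hv) (hx i)
    obtain ⟨j, hj⟩ := hp.1 x v hv'
    exact ⟨j.succ, by simpa using hj⟩
  · intro i j k hij hjk hlt heq
    obtain ⟨j, rfl⟩ := Fin.exists_succ_eq.2 (Fin.ne_zero_of_lt hij)
    obtain ⟨k, rfl⟩ := Fin.exists_succ_eq.2 (Fin.ne_zero_of_lt hjk)
    simp only [Fin.cons_succ] at hlt heq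
    cases i using Fin.cases with
    | zero => exact (hx j).not_gt (by simpa using hlt)
    | succ i =>
      exact hp.2 i j k (Fin.succ_lt_succ_iff.1 hij) (Fin.succ_lt_succ_iff.1 hjk)
        (by simpa using hlt) heq

/-- Deleting an element from a block preserves avoidance, provided that the block either
disappears and was the last one, or retains another element. -/
theorem comp_succAbove {n : ℕ} {q : Fin (n + 1) → ℕ} (hq : IsAvoider q) {x : Fin (n + 1)}
    (hx : (∀ i, q (x.succAbove i) < q x) ∨ ∃ i, q (x.succAbove i) = q x) :
    IsAvoider (q ∘ x.succAbove) := by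
  constructor
  · intro i v hv
    obtain ⟨j, hj⟩ := hq.1 _ v hv
    rcases Fin.eq_self_or_eq_succAbove x j with rfl | ⟨j, rfl⟩
    · rcases hx with hx | ⟨k, hk⟩
      · exact absurd (hj.trans_le hv) (hx i).not_ge
      · exact ⟨k, hk.trans hj⟩
    · exact ⟨j, hj⟩
  · intro i j k hij hjk
    exact hq.2 _ _ _ (Fin.succAbove_lt_succAbove_iff.2 hij) (Fin.succAbove_lt_succAbove_iff.2 hjk)

theorem numBlocks_comp_succAbove {n : ℕ} {q : Fin (n + 1) → ℕ} (hq : IsAvoider q)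
    {x : Fin (n + 1)} (hx : ∀ i, q (x.succAbove i) < q x) :
    numBlocks (q ∘ x.succAbove) = q x := by
  refine le_antisymm (Finset.sup_le fun i _ => hx i) (le_of_not_gt fun hlt => ?_)
  obtain ⟨j, hj⟩ := hq.1 x _ hlt.le
  rcases Fin.eq_self_or_eq_succAbove x j with rfl | ⟨j, rfl⟩
  · exact hlt.ne' hj
  · exact (lt_numBlocks (q ∘ x.succAbove) j).ne hj

/-- If the last block is not a singleton, it contains the first element. -/
theorem apply_zero_eq {n : ℕ} {q : Fin (n + 1) → ℕ} (hq : IsAvoider q) {x y : Fin (n + 1)}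
    (hx : ∀ i, q i ≤ q x) (hxy : x < y) (h : q x = q y) : q 0 = q x := by
  rcases (Fin.zero_le x).eq_or_lt with rfl | h0
  · rfl
  · exact le_antisymm (hx 0) (le_of_not_gt fun hlt => hq.2 0 x y h0 hxy hlt h)

end IsAvoider

/-- Either add a new last block `{x}`, or add a new first element to the last block. -/
def extendAvoider {n : ℕ} :
    (Fin (n + 2) × {p : Fin (n + 1) → ℕ // IsAvoider p}) ⊕ {p : Fin (n + 1) → ℕ // IsAvoider p} →
      {p : Fin (n + 2) → ℕ // IsAvoider p}
  | .inl (x, p) => ⟨x.insertNth (α := fun _ => ℕ) (numBlocks p.1) p.1, p.2.insertNth x⟩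
  | .inr p => ⟨Fin.cons (α := fun _ => ℕ) (numBlocks p.1 - 1) p.1, by
      obtain ⟨x, hx⟩ := exists_forall_le_apply p.1
      simpa [numBlocks_eq_of_forall_le hx] using p.2.cons hx⟩

theorem insertNth_numBlocks_le_iff {n : ℕ} (p : Fin n → ℕ) (x i : Fin (n + 1)) :
    numBlocks p ≤ x.insertNth (α := fun _ => ℕ) (numBlocks p) p i ↔ i = x := by
  rcases Fin.eq_self_or_eq_succAbove x i with rfl | ⟨i, rfl⟩
  · simp
  · simp [lt_numBlocks p i, Fin.succAbove_ne]

theorem numBlocks_insertNth {n : ℕ} (p : Fin n → ℕ) (x : Fin (n + 1)) :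
    numBlocks (x.insertNth (α := fun _ => ℕ) (numBlocks p) p) = numBlocks p + 1 := by
  have h := numBlocks_eq_of_forall_le (p := x.insertNth (α := fun _ => ℕ) (numBlocks p) p) (x := x)
  simp only [Fin.insertNth_apply_same] at h
  refine h fun i => ?_
  rcases Fin.eq_self_or_eq_succAbove x i with rfl | ⟨i, rfl⟩
  · simp
  · simpa using (lt_numBlocks p i).le

theorem insertNth_numBlocks_ne_cons {n : ℕ} (p q : Fin (n + 1) → ℕ) (x : Fin (n + 2)) :
    x.insertNth (α := fun _ => ℕ) (numBlocks p) p ≠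
      Fin.cons (α := fun _ => ℕ) (numBlocks q - 1) q := by
  intro h
  obtain ⟨y, hy⟩ := exists_forall_le_apply q
  rw [numBlocks_eq_of_forall_le hy, Nat.add_sub_cancel] at h
  have key := insertNth_numBlocks_le_iff p x
  rw [h] at key
  have hx := (key x).2 rfl
  have hle : numBlocks p ≤ q y := by
    cases x using Fin.cases with
    | zero => simpa using hx
    | succ i => exact le_trans (by simpa using hx) (hy i)
  have h0 := (key 0).1 (by simpa using hle)
  have h1 := (key y.succ).1 (by simpa using hle)
  exact Fin.succ_ne_zero y (h1.trans h0.symm)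

theorem extendAvoider_injective {n : ℕ} : Function.Injective (extendAvoider (n := n)) := by
  rintro (⟨x, p⟩ | p) (⟨y, q⟩ | q) h <;> have h := congrArg Subtype.val h <;>
    simp only [extendAvoider] at h
  · have hb : numBlocks p.1 = numBlocks q.1 := by
      have := congrArg numBlocks h
      simpa only [numBlocks_insertNth, Nat.add_right_cancel_iff] using this
    have hxy : x = y := by
      rw [← insertNth_numBlocks_le_iff q.1 y x, ← h, ← hb]
      simp
    subst hxy
    have hpq : p = q := Subtype.ext (by
      funext i
      simpa using congrFun h (x.succAbove i))
    rw [hpq]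
  · exact absurd h (insertNth_numBlocks_ne_cons _ _ _)
  · exact absurd h.symm (insertNth_numBlocks_ne_cons _ _ _)
  · have hpq : p = q := Subtype.ext (by
      funext i
      simpa using congrFun h i.succ)
    rw [hpq]

theorem extendAvoider_surjective {n : ℕ} : Function.Surjective (extendAvoider (n := n)) := by
  rintro ⟨q, hq⟩
  obtain ⟨x, hx⟩ := exists_forall_le_apply q
  by_cases hu : ∀ i, q (x.succAbove i) < q x
  · refine ⟨.inl (x, ⟨_, hq.comp_succAbove (.inl hu)⟩), Subtype.ext ?_⟩
    simp only [extendAvoider, hq.numBlocks_comp_succAbove hu]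
    exact Fin.insertNth_self_removeNth x q
  · push Not at hu
    obtain ⟨i, hi⟩ := hu
    have hi : q (x.succAbove i) = q x := le_antisymm (hx _) hi
    have h0 : q 0 = q x := by
      rcases lt_or_gt_of_ne (Fin.succAbove_ne x i) with hlt | hlt
      · exact (hq.apply_zero_eq (fun j => (hx j).trans hi.ge) hlt hi).trans hi
      · exact hq.apply_zero_eq hx hlt hi.symm
    have hz : ∃ z : Fin (n + 1), q z.succ = q 0 := by
      by_cases hx0 : x = 0
      · subst hx0
        exact ⟨i, by simpa using hi⟩
      · obtain ⟨z, rfl⟩ := Fin.exists_succ_eq.2 hx0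
        exact ⟨z, h0.symm⟩
    obtain ⟨z, hz⟩ := hz
    have htail : IsAvoider (Fin.tail q) := by
      have := hq.comp_succAbove (x := 0) (.inr ⟨z, by simpa using hz⟩)
      rwa [Fin.succAbove_zero] at this
    refine ⟨.inr ⟨_, htail⟩, Subtype.ext ?_⟩
    have hb : numBlocks (Fin.tail q) = q 0 + 1 := by
      rw [← hz]
      exact numBlocks_eq_of_forall_le (p := Fin.tail q) (x := z)
        fun j => (hx _).trans (h0.ge.trans hz.ge)
    simp only [extendAvoider, hb, Nat.add_sub_cancel]
    exact Fin.cons_self_tail q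

/-- Avoiders with values in `ℕ` are the same as avoiders with values in `Fin n`. -/
def avoiderEquiv (n : ℕ) :
    {p : Fin n → Fin n // IsOSP p ∧ ¬ ChainLtEq p} ≃ {p : Fin n → ℕ // IsAvoider p} where
  toFun p := ⟨fun i => p.1 i, by
    obtain ⟨p, h1, h2⟩ := p
    refine ⟨fun i v hv => ?_, fun i j k hij hjk hlt heq =>
      h2 ⟨i, j, k, hij, hjk, hlt, Fin.ext heq⟩⟩
    obtain ⟨j, hj⟩ := h1 i ⟨v, hv.trans_lt (p i).2⟩ hv
    exact ⟨j, congrArg Fin.val hj⟩⟩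
  invFun p := ⟨fun i => ⟨p.1 i, p.2.apply_lt i⟩, by
    obtain ⟨p, hp⟩ := p
    refine ⟨fun i v hv => ?_, ?_⟩
    · obtain ⟨j, hj⟩ := hp.1 i v hv
      exact ⟨j, Fin.ext hj⟩
    · rintro ⟨i, j, k, hij, hjk, hlt, heq⟩
      exact hp.2 i j k hij hjk hlt (congrArg Fin.val heq)⟩
  left_inv _ := rfl
  right_inv _ := rfl

theorem card_avoider_succ (n : ℕ) :
    Nat.card {p : Fin (n + 2) → ℕ // IsAvoider p} =
      (n + 3) * Nat.card {p : Fin (n + 1) → ℕ // IsAvoider p} := by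
  have : Finite {p : Fin (n + 1) → ℕ // IsAvoider p} := Finite.of_equiv _ (avoiderEquiv (n + 1))
  rw [← Nat.card_congr (Equiv.ofBijective _ ⟨extendAvoider_injective, extendAvoider_surjective⟩),
    Nat.card_sum, Nat.card_prod, Nat.card_fin]
  ring

theorem card_avoider_one : Nat.card {p : Fin 1 → ℕ // IsAvoider p} = 1 := by
  rw [Nat.card_eq_one_iff_unique]
  refine ⟨⟨fun p q => Subtype.ext (funext fun i => ?_)⟩, ⟨⟨fun _ => 0, ?_, ?_⟩⟩⟩
  · have := p.2.apply_lt i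
    have := q.2.apply_lt i
    omega
  · exact fun i v hv => ⟨i, (Nat.le_zero.1 hv).symm⟩
  · exact fun _ _ _ _ _ hlt => absurd hlt (lt_irrefl _)

theorem two_mul_card_avoider (n : ℕ) :
    2 * Nat.card {p : Fin (n + 1) → ℕ // IsAvoider p} = (n + 2).factorial := by
  induction n with
  | zero => rw [card_avoider_one]; rfl
  | succ n ih =>
    rw [card_avoider_succ, Nat.factorial_succ (n + 2), ← ih]
    ring

/-- The number of ordered set partitions of `[n]` avoiding the condition
`x_{i1} < x_{i2} = x_{i3}` equals `(n+1)!/2`. -/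
theorem woc_active_lteq (n : ℕ) (hn : 1 ≤ n) :
    Nat.card {p : Fin n → Fin n // IsOSP p ∧ ¬ ChainLtEq p}
      = (n + 1).factorial / 2 := by
  obtain ⟨n, rfl⟩ := Nat.exists_eq_succ_of_ne_zero (Nat.one_le_iff_ne_zero.1 hn)
  rw [Nat.card_congr (avoiderEquiv _)]
  have := two_mul_card_avoider n
  simp only [Nat.succ_eq_add_one, add_assoc, Nat.reduceAdd] at *
  omega
end

section
/- Let Δ_n be the number of ordered set partitions of [n] that contain the condition x_{i1} < x_{i2} = x_{i3} (i.e., there exist indices i1 < i2 < i3 with pos(i1) < pos(i2) = pos(i3)) but whose restriction to [n−1] avoids this condition. Then Δ_1 = Δ_2 = 0, Δ_n = n·Δ_{n−1} + (n−2)·a_{n−2} for all n ≥ 3, where a_m = (m+1)!/2 for m ≥ 1 and a_0 = 1, and explicitly Δ_n = (n!/2)·Σ_{k=3}^{n} (k−2)/k for all n ≥ 3. -/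
/- Deleting the element `n` from an ordered set partition of `[n]` preserves block
membership and the relative order of the blocks of the remaining elements, so the
restriction to `[n-1]` contains a given stopping condition iff the condition occurs
with all of its witnesses among the elements of `[n-1]`, i.e. among the indices `i`
with `i.val < n - 1`. -/

/-- `a_m` is the number of ordered set partitions of `[m]` avoiding the condition
`x_{i1} < x_{i2} = x_{i3}` (equal to `(m+1)!/2` for `m ≥ 1`, with `a_0 = 1`). -/
noncomputable def aLtEq (n : ℕ) : ℕ :=
  Nat.card {p : Fin n → Fin n // IsOSP p ∧ ¬ ChainLtEq p}

/-- `Δ_n` is the number of ordered set partitions of `[n]` that contain the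
condition `x_{i1} < x_{i2} = x_{i3}` but whose restriction to `[n-1]` avoids it. -/
noncomputable def deltaLtEq (n : ℕ) : ℕ :=
  Nat.card {p : Fin n → Fin n // IsOSP p ∧ ChainLtEq p ∧
    ¬ ∃ i j k : Fin n, i.val < n - 1 ∧ j.val < n - 1 ∧ k.val < n - 1 ∧
      i < j ∧ j < k ∧ p i < p j ∧ p j = p k}

/-- The second component encodes an ordered set partition with exactly `ℓ` blocks, where `ℓ` is
the first component: its range is `{0, …, ℓ - 1}`. -/
def IsWord {n : ℕ} (x : ℕ × (Fin n → ℕ)) : Prop :=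
  (∀ i, x.2 i < x.1) ∧ ∀ v < x.1, ∃ i, x.2 i = v

/-- The pattern `x_{i1} < x_{i2} = x_{i3}` in a word of natural numbers. -/
def HasChain {n : ℕ} (f : Fin n → ℕ) : Prop :=
  ∃ i j k : Fin n, i < j ∧ j < k ∧ f i < f j ∧ f j = f k

/-- Words avoiding the pattern, with their number of blocks. -/
def avoiders (n : ℕ) : Set (ℕ × (Fin n → ℕ)) :=
  {x | IsWord x ∧ ¬ HasChain x.2}

/-- Words of length `n + 1` whose last letter creates the first occurrence of the pattern. -/
def stopped (n : ℕ) : Set (ℕ × (Fin (n + 1) → ℕ)) :=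
  {x | IsWord x ∧ HasChain x.2 ∧ ¬ HasChain (Fin.init x.2)}

theorem lt_length_of_initial_segment {n : ℕ} {f : Fin n → ℕ}
    (h : ∀ i, ∀ v ≤ f i, ∃ j, f j = v) (i : Fin n) : f i < n := by
  have hs : Finset.range (f i + 1) ⊆ Finset.univ.image f := by
    intro v hv
    obtain ⟨j, hj⟩ := h i v (by simpa [Nat.lt_succ_iff] using hv)
    simp only [Finset.mem_image, Finset.mem_univ, true_and]
    exact ⟨j, hj⟩
  have h1 := Finset.card_le_card hs
  have h2 := Finset.card_image_le (s := Finset.univ) (f := f)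
  simp at h1 h2
  omega

theorem IsWord.initial_segment {n : ℕ} {x : ℕ × (Fin n → ℕ)} (h : IsWord x) :
    ∀ i, ∀ v ≤ x.2 i, ∃ j, x.2 j = v :=
  fun i v hv => h.2 v (hv.trans_lt (h.1 i))

theorem IsWord.exists_of_initial_segment {n : ℕ} {f : Fin n → ℕ}
    (h : ∀ i, ∀ v ≤ f i, ∃ j, f j = v) : ∃ l, IsWord (l, f) := by
  refine ⟨Finset.univ.sup fun i => f i + 1, fun i => ?_, fun v hv => ?_⟩
  · exact Finset.le_sup (f := fun i => f i + 1) (Finset.mem_univ i)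
  · obtain ⟨i, -, hi⟩ := Finset.lt_sup_iff.1
      (show v < Finset.univ.sup fun i => f i + 1 from hv)
    exact h i v (Nat.lt_succ_iff.1 hi)

theorem IsWord.fst_le_of_snd_eq {n : ℕ} {x y : ℕ × (Fin n → ℕ)} (hx : IsWord x) (hy : IsWord y)
    (h : x.2 = y.2) : x.1 ≤ y.1 := by
  by_contra! hlt
  obtain ⟨i, hi⟩ := hx.2 _ hlt
  have := hy.1 i
  rw [h] at hi
  omega

theorem IsWord.injOn_snd (n : ℕ) : Set.InjOn Prod.snd {x : ℕ × (Fin n → ℕ) | IsWord x} :=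
  fun _ hx _ hy h => Prod.ext
    ((hx.fst_le_of_snd_eq hy h).antisymm (hy.fst_le_of_snd_eq hx h.symm)) h

theorem finite_setOf_isWord (n : ℕ) : {x : ℕ × (Fin n → ℕ) | IsWord x}.Finite := by
  refine Set.Finite.of_finite_image ?_ (IsWord.injOn_snd n)
  refine (Set.Finite.pi' fun _ : Fin n => Set.finite_Iio n).subset ?_
  rintro _ ⟨x, hx, rfl⟩ i
  exact lt_length_of_initial_segment (IsWord.initial_segment hx) i

theorem finite_avoiders (n : ℕ) : (avoiders n).Finite :=
  (finite_setOf_isWord n).subset fun _ h => h.1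

theorem finite_stopped (n : ℕ) : (stopped n).Finite :=
  (finite_setOf_isWord (n + 1)).subset fun _ h => h.1

theorem card_isOSP_and {n : ℕ} (Q : (Fin n → ℕ) → Prop) :
    Nat.card {p : Fin n → Fin n // IsOSP p ∧ Q (fun i => p i)} =
      {x : ℕ × (Fin n → ℕ) | IsWord x ∧ Q x.2}.ncard := by
  have h1 : {x : ℕ × (Fin n → ℕ) | IsWord x ∧ Q x.2}.ncard =
      (Prod.snd '' {x : ℕ × (Fin n → ℕ) | IsWord x ∧ Q x.2}).ncard :=
    ((IsWord.injOn_snd n).mono fun _ h => h.1).ncard_image.symm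
  have h2 : Function.Injective fun (p : Fin n → Fin n) (i : Fin n) => (p i : ℕ) :=
    fun p q h => funext fun i => Fin.ext (congrFun h i)
  have h3 := Set.ncard_image_of_injective {p : Fin n → Fin n | IsOSP p ∧ Q (fun i => p i)} h2
  rw [h1]
  refine h3.symm.trans ?_
  congr 1
  ext f
  constructor
  · rintro ⟨p, ⟨hp, hQ⟩, rfl⟩
    have : ∀ i, ∀ v ≤ (p i : ℕ), ∃ j, (p j : ℕ) = v := fun i v hv => by
      obtain ⟨j, hj⟩ := hp i ⟨v, hv.trans_lt (p i).2⟩ hv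
      exact ⟨j, by rw [hj]⟩
    obtain ⟨l, hl⟩ := IsWord.exists_of_initial_segment this
    exact ⟨(l, _), ⟨hl, hQ⟩, rfl⟩
  · rintro ⟨x, ⟨hx, hQ⟩, rfl⟩
    refine ⟨fun i => ⟨x.2 i, lt_length_of_initial_segment hx.initial_segment i⟩,
      ⟨fun i v hv => ?_, hQ⟩, rfl⟩
    obtain ⟨j, hj⟩ := hx.initial_segment i v hv
    exact ⟨j, Fin.ext hj⟩

theorem aLtEq_eq_ncard (n : ℕ) : aLtEq n = (avoiders n).ncard := by
  rw [aLtEq, avoiders, ← card_isOSP_and fun f => ¬ HasChain f]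
  simp only [ChainLtEq, HasChain, Fin.lt_def, Fin.ext_iff]

theorem hasChain_init_iff {n : ℕ} (f : Fin (n + 1) → ℕ) :
    HasChain (Fin.init f) ↔ ∃ i j k : Fin (n + 1), i.val < n ∧ j.val < n ∧ k.val < n ∧
      i < j ∧ j < k ∧ f i < f j ∧ f j = f k := by
  constructor
  · rintro ⟨i, j, k, h⟩
    exact ⟨i.castSucc, j.castSucc, k.castSucc, i.2, j.2, k.2, h⟩
  · rintro ⟨i, j, k, hi, hj, hk, h⟩
    exact ⟨⟨i, hi⟩, ⟨j, hj⟩, ⟨k, hk⟩, h⟩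

theorem deltaLtEq_succ_eq_ncard (n : ℕ) : deltaLtEq (n + 1) = (stopped n).ncard := by
  rw [deltaLtEq, stopped, ← card_isOSP_and fun f => HasChain f ∧ ¬ HasChain (Fin.init f)]
  simp only [hasChain_init_iff]
  simp only [ChainLtEq, HasChain, Fin.lt_def, Fin.ext_iff, Nat.add_sub_cancel]

theorem HasChain.of_comp {m n : ℕ} {f : Fin n → ℕ} {g : Fin m → Fin n} (hg : StrictMono g)
    (h : HasChain (f ∘ g)) : HasChain f := by
  obtain ⟨i, j, k, hij, hjk, h⟩ := h
  exact ⟨g i, g j, g k, hg hij, hg hjk, h⟩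

theorem hasChain_cons_iff {n : ℕ} {f : Fin n → ℕ} {M : ℕ} (h : ∀ i, f i ≤ M) :
    HasChain (Fin.cons M f : Fin (n + 1) → ℕ) ↔ HasChain f := by
  constructor
  · rintro ⟨i, j, k, hij, hjk, hlt, heq⟩
    cases j using Fin.cases with
    | zero => simp at hij
    | succ j =>
      cases k using Fin.cases with
      | zero => simp at hjk
      | succ k =>
        cases i using Fin.cases with
        | zero => exact absurd (h j) (by simpa using hlt)
        | succ i => exact ⟨i, j, k, by simpa using hij, by simpa using hjk, by simpa using hlt,
            by simpa using heq⟩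
  · intro hf
    exact HasChain.of_comp (g := Fin.succ) (Fin.strictMono_succ) hf

theorem hasChain_insertNth_iff {n : ℕ} {f : Fin n → ℕ} {M : ℕ} (h : ∀ i, f i < M)
    (p : Fin (n + 1)) : HasChain (p.insertNth M f : Fin (n + 1) → ℕ) ↔ HasChain f := by
  constructor
  · rintro ⟨i, j, k, hij, hjk, hlt, heq⟩
    cases j using Fin.succAboveCases p with
    | x =>
      cases k using Fin.succAboveCases p with
      | x => simp at hjk
      | p k => exact absurd (h k) (by simp at heq; omega)
    | p j =>
      cases k using Fin.succAboveCases p with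
      | x => exact absurd (h j) (by simp at heq; omega)
      | p k =>
        cases i using Fin.succAboveCases p with
        | x => exact absurd (h j) (by simp at hlt; omega)
        | p i => exact ⟨i, j, k, by simpa using hij, by simpa using hjk, by simpa using hlt,
            by simpa using heq⟩
  · intro hf
    refine HasChain.of_comp (g := p.succAbove) (Fin.strictMono_succAbove p) ?_
    convert hf using 1
    ext i
    simp

theorem IsWord.insertNth {n l : ℕ} {f : Fin n → ℕ} (h : IsWord (l, f)) (p : Fin (n + 1)) :
    IsWord (l + 1, (p.insertNth l f : Fin (n + 1) → ℕ)) := by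
  refine ⟨fun i => ?_, fun v hv => ?_⟩
  · cases i using Fin.succAboveCases p with
    | x => simp
    | p i => simpa using (h.1 i).trans (Nat.lt_succ_self l)
  · rcases (Nat.lt_succ_iff.1 hv).eq_or_lt with rfl | hv
    · exact ⟨p, by simp⟩
    · obtain ⟨i, hi⟩ := h.2 v hv
      exact ⟨p.succAbove i, by simpa using hi⟩

/-- Removing the unique occurrence of the largest letter. -/
theorem IsWord.removeNth {n l : ℕ} {f : Fin (n + 1) → ℕ} (h : IsWord (l + 1, f)) {p : Fin (n + 1)}
    (hp : ∀ i, f i = l ↔ i = p) : IsWord (l, p.removeNth f) := by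
  refine ⟨fun i => ?_, fun v hv => ?_⟩
  · have h1 := h.1 (p.succAbove i)
    have h2 : f (p.succAbove i) ≠ l := fun h => Fin.succAbove_ne p i ((hp _).1 h)
    simp only [Fin.removeNth] at *
    omega
  · obtain ⟨i, hi⟩ := h.2 v (hv.trans (Nat.lt_succ_self l))
    have hi' : i ≠ p := fun h' => by
      have := (hp i).2 h'
      simp only at hi
      omega
    obtain ⟨j, rfl⟩ := Fin.exists_succAbove_eq hi'
    exact ⟨j, hi⟩

theorem IsWord.cons {n l v : ℕ} {f : Fin n → ℕ} (h : IsWord (l, f)) (hv : v < l) :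
    IsWord (l, (Fin.cons v f : Fin (n + 1) → ℕ)) := by
  refine ⟨fun i => ?_, fun w hw => ?_⟩
  · cases i using Fin.cases with
    | zero => simpa using hv
    | succ i => simpa using h.1 i
  · obtain ⟨i, hi⟩ := h.2 w hw
    exact ⟨i.succ, by simpa using hi⟩

theorem IsWord.tail {n l : ℕ} {f : Fin (n + 1) → ℕ} (h : IsWord (l, f)) {j : Fin n}
    (hj : f j.succ = f 0) : IsWord (l, Fin.tail f) := by
  refine ⟨fun i => h.1 i.succ, fun w hw => ?_⟩
  obtain ⟨i, hi⟩ := h.2 w hw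
  cases i using Fin.cases with
  | zero => exact ⟨j, hj.trans hi⟩
  | succ i => exact ⟨i, hi⟩

theorem IsWord.snoc {n l v : ℕ} {f : Fin n → ℕ} (h : IsWord (l, f)) (hv : v < l) :
    IsWord (l, (Fin.snoc f v : Fin (n + 1) → ℕ)) := by
  refine ⟨fun i => ?_, fun w hw => ?_⟩
  · cases i using Fin.lastCases with
    | last => simpa using hv
    | cast i => simpa using h.1 i
  · obtain ⟨i, hi⟩ := h.2 w hw
    exact ⟨i.castSucc, by simpa using hi⟩

theorem IsWord.init {n l : ℕ} {f : Fin (n + 1) → ℕ} (h : IsWord (l, f)) {j : Fin n}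
    (hj : f j.castSucc = f (Fin.last n)) : IsWord (l, Fin.init f) := by
  refine ⟨fun i => h.1 i.castSucc, fun w hw => ?_⟩
  obtain ⟨i, hi⟩ := h.2 w hw
  cases i using Fin.lastCases with
  | last => exact ⟨j, hj.trans hi⟩
  | cast i => exact ⟨i, hi⟩

theorem insertNth_eq_iff {n l : ℕ} {f : Fin n → ℕ} (h : IsWord (l, f)) (p i : Fin (n + 1)) :
    (p.insertNth l f : Fin (n + 1) → ℕ) i = l ↔ i = p := by
  cases i using Fin.succAboveCases p with
  | x => simp
  | p i =>
    have := h.1 i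
    simp only at this
    simp [this.ne]

/-- Prepend a further occurrence of the largest letter. -/
def consTop {n : ℕ} (x : ℕ × (Fin n → ℕ)) : ℕ × (Fin (n + 1) → ℕ) :=
  (x.1, Fin.cons (x.1 - 1) x.2)

/-- Insert a new largest letter. -/
def insertTop {n : ℕ} (y : Fin (n + 1) × (ℕ × (Fin n → ℕ))) : ℕ × (Fin (n + 1) → ℕ) :=
  (y.2.1 + 1, y.1.insertNth y.2.1 y.2.2)

/-- Append a further occurrence of the largest letter. -/
def snocTop {n : ℕ} (x : ℕ × (Fin n → ℕ)) : ℕ × (Fin (n + 1) → ℕ) :=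
  (x.1, Fin.snoc x.2 (x.1 - 1))

theorem consTop_injective {n : ℕ} : Function.Injective (consTop (n := n)) := by
  rintro ⟨l, f⟩ ⟨l', f'⟩ h
  simp only [consTop, Prod.mk.injEq, Fin.cons_inj] at h
  exact Prod.ext h.1 h.2.2

theorem snocTop_injective {n : ℕ} : Function.Injective (snocTop (n := n)) := by
  rintro ⟨l, f⟩ ⟨l', f'⟩ h
  simp only [snocTop, Prod.mk.injEq] at h
  exact Prod.ext h.1 (by simpa using congrArg (Fin.init (α := fun _ => ℕ)) h.2)

theorem insertTop_injOn {n : ℕ} : Set.InjOn (insertTop (n := n)) {y | IsWord y.2} := by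
  rintro ⟨p, l, f⟩ h ⟨p', l', f'⟩ h' heq
  simp only [insertTop, Prod.mk.injEq, Nat.add_right_cancel_iff] at heq
  obtain ⟨rfl, heq⟩ := heq
  obtain rfl : p = p' := by
    rw [← insertNth_eq_iff h', ← heq, insertNth_eq_iff h]
  simpa using congrArg (Fin.removeNth p) heq

theorem IsWord.exists_eq_succ {n l : ℕ} {f : Fin (n + 1) → ℕ} (h : IsWord (l, f)) :
    ∃ M, l = M + 1 :=
  Nat.exists_eq_succ_of_ne_zero (Nat.ne_zero_of_lt (h.1 0))

theorem IsWord.le_of_succ {n M : ℕ} {f : Fin n → ℕ} (h : IsWord (M + 1, f)) (i : Fin n) :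
    f i ≤ M :=
  Nat.lt_succ_iff.1 (h.1 i)

theorem IsWord.consTop {n : ℕ} {x : ℕ × (Fin (n + 1) → ℕ)} (h : IsWord x) :
    IsWord (consTop x) :=
  IsWord.cons h (by have := h.1 0; omega)

theorem IsWord.snocTop {n : ℕ} {x : ℕ × (Fin (n + 1) → ℕ)} (h : IsWord x) :
    IsWord (snocTop x) :=
  IsWord.snoc h (by have := h.1 0; omega)

theorem IsWord.hasChain_consTop_iff {n : ℕ} {x : ℕ × (Fin n → ℕ)} (h : IsWord x) :
    HasChain (_root_.consTop x).2 ↔ HasChain x.2 :=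
  hasChain_cons_iff fun i => Nat.le_sub_one_of_lt (h.1 i)

/-- The largest letter occurs only once. -/
def TopUnique {n : ℕ} (x : ℕ × (Fin n → ℕ)) : Prop :=
  ∀ i j, x.2 i + 1 = x.1 → x.2 j + 1 = x.1 → i = j

theorem not_topUnique_consTop {n : ℕ} {x : ℕ × (Fin (n + 1) → ℕ)} (h : IsWord x) :
    ¬ TopUnique (consTop x) := by
  have h0 := h.1 0
  obtain ⟨i, hi⟩ := h.2 (x.1 - 1) (by omega)
  intro ht
  refine (Fin.succ_ne_zero i).symm (ht 0 i.succ ?_ ?_) <;> simp [consTop] <;> omega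

theorem topUnique_insertTop {n : ℕ} {y : Fin (n + 1) × (ℕ × (Fin n → ℕ))} (h : IsWord y.2) :
    TopUnique (insertTop y) := by
  intro i j hi hj
  have hi' := (insertNth_eq_iff h y.1 i).1 (Nat.succ_injective hi)
  have hj' := (insertNth_eq_iff h y.1 j).1 (Nat.succ_injective hj)
  rw [hi', hj']

theorem eq_insertTop_of_topUnique {n M : ℕ} {f : Fin (n + 1) → ℕ} (h : IsWord (M + 1, f))
    (ht : TopUnique (M + 1, f)) :
    ∃ p, f p = M ∧ IsWord (M, p.removeNth f) ∧ insertTop (p, (M, p.removeNth f)) = (M + 1, f) := by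
  obtain ⟨p, hp⟩ := h.2 M (Nat.lt_succ_self M)
  simp only at hp
  have hp' : ∀ i, f i = M ↔ i = p := fun i =>
    ⟨fun hi => ht i p (congrArg Nat.succ hi) (congrArg Nat.succ hp), fun hi => hi ▸ hp⟩
  refine ⟨p, hp, h.removeNth hp', ?_⟩
  simp only [insertTop, Prod.mk.injEq, true_and]
  rw [← hp, Fin.insertNth_self_removeNth]

theorem eq_consTop {n M : ℕ} {f : Fin (n + 1) → ℕ} (h : IsWord (M + 1, f)) (h0 : f 0 = M)
    (ht : ¬ TopUnique (M + 1, f)) :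
    IsWord (M + 1, Fin.tail f) ∧ consTop (M + 1, Fin.tail f) = (M + 1, f) := by
  have : ∃ j : Fin n, f j.succ = f 0 := by
    by_contra! hne
    have hz : ∀ i, f i + 1 = M + 1 → i = 0 := fun i hi => by
      cases i using Fin.cases with
      | zero => rfl
      | succ i => exact absurd (hne i) (by simp; omega)
    exact ht fun i j hi hj => (hz i hi).trans (hz j hj).symm
  obtain ⟨j, hj⟩ := this
  refine ⟨h.tail hj, ?_⟩
  simp only [consTop, Nat.add_sub_cancel, ← h0, Fin.cons_self_tail]

/-- If the word does not start with its largest letter, then two occurrences of that letter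
create the pattern. -/
theorem hasChain_of_top_repeated {n M : ℕ} {f : Fin (n + 1) → ℕ} (h : IsWord (M + 1, f))
    (h0 : f 0 ≠ M) {i j : Fin (n + 1)} (hij : i < j) (hi : f i = M) (hj : f j = M) :
    HasChain f := by
  have hi0 : 0 < i := Fin.pos_iff_ne_zero.2 fun h' => h0 (h' ▸ hi)
  exact ⟨0, i, j, hi0, hij, hi ▸ (h.le_of_succ 0).lt_of_ne h0, hi.trans hj.symm⟩

theorem ncard_avoiders_add_two (n : ℕ) :
    (avoiders (n + 2)).ncard = (n + 3) * (avoiders (n + 1)).ncard := by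
  have key : avoiders (n + 2) = consTop '' avoiders (n + 1) ∪
      insertTop '' (Set.univ ×ˢ avoiders (n + 1)) := by
    ext x
    constructor
    · obtain ⟨l, f⟩ := x
      rintro ⟨hw, hc⟩
      obtain ⟨M, rfl⟩ := hw.exists_eq_succ
      by_cases ht : TopUnique (M + 1, f)
      · obtain ⟨p, hp, hw', heq⟩ := eq_insertTop_of_topUnique hw ht
        exact .inr ⟨_, ⟨trivial, hw', mt (.of_comp (Fin.strictMono_succAbove p)) hc⟩, heq⟩
      · by_cases h0 : f 0 = M
        · obtain ⟨hw', heq⟩ := eq_consTop hw h0 ht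
          exact .inl ⟨_, ⟨hw', mt (.of_comp Fin.strictMono_succ) hc⟩, heq⟩
        · refine absurd (fun i j hi hj => ?_) ht
          have hi := Nat.succ_injective hi
          have hj := Nat.succ_injective hj
          by_contra hne
          rcases lt_or_gt_of_ne hne with h | h
          · exact hc (hasChain_of_top_repeated hw h0 h hi hj)
          · exact hc (hasChain_of_top_repeated hw h0 h hj hi)
    · rintro (⟨x, ⟨hw, hc⟩, rfl⟩ | ⟨⟨p, x⟩, ⟨-, hw, hc⟩, rfl⟩)
      · exact ⟨hw.consTop, mt hw.hasChain_consTop_iff.1 hc⟩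
      · exact ⟨hw.insertNth p, mt (hasChain_insertNth_iff hw.1 p).1 hc⟩
  have hfin := finite_avoiders (n + 1)
  rw [key, Set.ncard_union_eq ?_ (hfin.image _) ((Set.finite_univ.prod hfin).image _),
    Set.ncard_image_of_injective _ consTop_injective,
    (insertTop_injOn.mono fun y hy => hy.2.1).ncard_image, Set.ncard_prod, Set.ncard_univ,
    Nat.card_fin]
  · ring
  · rw [Set.disjoint_left]
    rintro _ ⟨x, hx, rfl⟩ ⟨y, hy, heq⟩
    exact not_topUnique_consTop hx.1 (heq ▸ topUnique_insertTop hy.2.1)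

theorem init_insertNth_castSucc {n : ℕ} (p : Fin (n + 1)) (l : ℕ) (f : Fin (n + 1) → ℕ) :
    Fin.init (p.castSucc.insertNth l f : Fin (n + 2) → ℕ) =
      (p.insertNth l (Fin.init f) : Fin (n + 1) → ℕ) := by
  ext i
  cases i using Fin.succAboveCases p with
  | x => simp [Fin.init]
  | p i =>
    rw [Fin.insertNth_apply_succAbove]
    simp only [Fin.init, ← Fin.castSucc_succAbove_castSucc]
    rw [Fin.insertNth_apply_succAbove]

theorem init_cons {n : ℕ} (v : ℕ) (f : Fin (n + 1) → ℕ) :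
    Fin.init (Fin.cons v f : Fin (n + 2) → ℕ) = (Fin.cons v (Fin.init f) : Fin (n + 1) → ℕ) := by
  ext i
  cases i using Fin.cases <;> rfl

/-- Insert a new largest letter that is not at the start, and repeat it at the end. -/
def insertSnocTop {n : ℕ} (y : Fin n × (ℕ × (Fin n → ℕ))) : ℕ × (Fin (n + 2) → ℕ) :=
  snocTop (insertTop (y.1.succ, y.2))

theorem insertSnocTop_injOn {n : ℕ} :
    Set.InjOn (insertSnocTop (n := n)) {y | IsWord y.2} := by
  rintro ⟨p, x⟩ h ⟨p', x'⟩ h' heq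
  have := insertTop_injOn h h' (snocTop_injective heq)
  simpa using this

theorem not_topUnique_insertSnocTop {n : ℕ} {y : Fin n × (ℕ × (Fin n → ℕ))} :
    ¬ TopUnique (insertSnocTop y) := fun ht =>
  (Fin.castSucc_lt_last y.1.succ).ne (ht _ _
    (by simp [insertSnocTop, snocTop, insertTop, -Fin.castSucc_succ])
    (by simp [insertSnocTop, snocTop, insertTop]))

theorem insertSnocTop_zero {n : ℕ} {y : Fin n × (ℕ × (Fin n → ℕ))} (h : IsWord y.2) :
    (insertSnocTop y).2 0 ≠ y.2.1 := by
  simp only [insertSnocTop, snocTop, insertTop]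
  rw [← Fin.castSucc_zero, Fin.snoc_castSucc, Ne, insertNth_eq_iff h]
  exact (Fin.succ_ne_zero _).symm

theorem insertSnocTop_mem_stopped {n : ℕ} {y : Fin n × (ℕ × (Fin n → ℕ))}
    (h : y.2 ∈ avoiders n) : insertSnocTop y ∈ stopped (n + 1) := by
  have hw : IsWord (insertSnocTop y) := (h.1.insertNth _).snocTop
  refine ⟨hw, ?_, ?_⟩
  · exact hasChain_of_top_repeated hw (insertSnocTop_zero h.1) (Fin.castSucc_lt_last y.1.succ)
      (by simp [insertSnocTop, snocTop, insertTop, -Fin.castSucc_succ])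
      (by simp [insertSnocTop, snocTop, insertTop])
  · simp only [insertSnocTop, snocTop, Fin.init_snoc]
    exact mt (hasChain_insertNth_iff h.1.1 _).1 h.2

theorem ncard_stopped_succ (n : ℕ) :
    (stopped (n + 1)).ncard = (n + 2) * (stopped n).ncard + n * (avoiders n).ncard := by
  have key : stopped (n + 1) = (consTop '' stopped n ∪
      (fun y : Fin (n + 1) × _ => insertTop (y.1.castSucc, y.2)) '' (Set.univ ×ˢ stopped n)) ∪
      insertSnocTop '' (Set.univ ×ˢ avoiders n) := by
    ext x
    constructor
    · obtain ⟨l, f⟩ := x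
      rintro ⟨hw, hc, hi⟩
      obtain ⟨M, rfl⟩ := hw.exists_eq_succ
      by_cases ht : TopUnique (M + 1, f)
      · obtain ⟨p, hp, hw', heq⟩ := eq_insertTop_of_topUnique hw ht
        have hf : f = p.insertNth M (p.removeNth f) := congrArg Prod.snd heq.symm
        have hc' : HasChain (p.removeNth f) := by
          simp only at hc
          rwa [hf, hasChain_insertNth_iff hw'.1] at hc
        cases p using Fin.lastCases with
        | last =>
          refine absurd ?_ hi
          simpa [Fin.removeNth, Fin.init, Function.comp_def] using hc'
        | cast p =>
          refine .inl (.inr ⟨(p, _), ⟨trivial, hw', hc', fun h => hi ?_⟩, heq⟩)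
          simp only
          rw [hf, init_insertNth_castSucc]
          exact (hasChain_insertNth_iff (fun i => hw'.1 i.castSucc) p).2 h
      · by_cases h0 : f 0 = M
        · obtain ⟨hw', heq⟩ := eq_consTop hw h0 ht
          have hc' := hw'.hasChain_consTop_iff.1 (heq ▸ hc)
          exact .inl (.inl ⟨_, ⟨hw', hc', mt (.of_comp (f := Fin.init f) Fin.strictMono_succ) hi⟩,
            heq⟩)
        · have h0i : Fin.init f 0 ≠ M := h0
          have hti : ∀ i j : Fin (n + 1), i < j → f i.castSucc = M → f j.castSucc = M → False :=
            fun i j hij hfi hfj => hi ⟨0, i, j,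
              Fin.pos_iff_ne_zero.2 fun h' => h0 (by simpa [h'] using hfi), hij,
              lt_of_lt_of_eq ((hw.le_of_succ 0).lt_of_ne h0) hfi.symm, hfi.trans hfj.symm⟩
          have hti' : TopUnique (M + 1, Fin.init f) := fun i j h1 h2 => by
            have h1 := Nat.succ_injective h1
            have h2 := Nat.succ_injective h2
            by_contra hne
            rcases lt_or_gt_of_ne hne with h | h
            exacts [hti _ _ h h1 h2, hti _ _ h h2 h1]
          have hlast : ∃ j : Fin (n + 1), f j.castSucc = M ∧ f (Fin.last _) = M := by
            simp only [TopUnique] at ht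
            push Not at ht
            obtain ⟨i, j, h1, h2, hne⟩ := ht
            have h1 := Nat.succ_injective h1
            have h2 := Nat.succ_injective h2
            cases i using Fin.lastCases with
            | last =>
              cases j using Fin.lastCases with
              | last => exact absurd rfl hne
              | cast j => exact ⟨j, h2, h1⟩
            | cast i =>
              cases j using Fin.lastCases with
              | last => exact ⟨i, h1, h2⟩
              | cast j =>
                exact absurd (congrArg Fin.castSucc
                  (hti' i j (congrArg Nat.succ h1) (congrArg Nat.succ h2))) hne
          obtain ⟨j, hj, hl⟩ := hlast
          have hwi : IsWord (M + 1, Fin.init f) := hw.init (hj.trans hl.symm)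
          obtain ⟨p, hp, hw', heq⟩ := eq_insertTop_of_topUnique hwi hti'
          obtain ⟨q, rfl⟩ := Fin.exists_succ_eq.2 (show p ≠ 0 from fun h => h0i (h ▸ hp))
          refine .inr ⟨(q, _), ⟨trivial, hw',
            mt (.of_comp (f := Fin.init f) (Fin.strictMono_succAbove q.succ)) hi⟩, ?_⟩
          refine (congrArg snocTop heq).trans ?_
          simp only [snocTop, Nat.add_sub_cancel, ← hl, Fin.snoc_init_self]
    · rintro ((⟨x, ⟨hw, hc, hi⟩, rfl⟩ | ⟨⟨p, x⟩, ⟨-, hw, hc, hi⟩, rfl⟩) | ⟨y, ⟨-, hy⟩, rfl⟩)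
      · refine ⟨hw.consTop, hw.hasChain_consTop_iff.2 hc, ?_⟩
        simp only [consTop, init_cons]
        exact mt (hasChain_cons_iff fun i => Nat.le_sub_one_of_lt (hw.1 i.castSucc)).1 hi
      · refine ⟨hw.insertNth _, (hasChain_insertNth_iff hw.1 _).2 hc, ?_⟩
        simp only [insertTop, init_insertNth_castSucc]
        exact mt (hasChain_insertNth_iff (fun i => hw.1 i.castSucc) p).1 hi
      · exact insertSnocTop_mem_stopped hy
  have hfin := finite_stopped n
  have h1 := hfin.image (consTop (n := n + 1))
  have h2 := (Set.finite_univ.prod hfin).image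
    fun y : Fin (n + 1) × _ => insertTop (y.1.castSucc, y.2)
  have h3 := (Set.finite_univ.prod (finite_avoiders n)).image (insertSnocTop (n := n))
  have hinj : Set.InjOn (fun y : Fin (n + 1) × _ => insertTop (y.1.castSucc, y.2))
      (Set.univ ×ˢ stopped n) := by
    rintro ⟨p, x⟩ h ⟨p', x'⟩ h' heq
    simpa using insertTop_injOn (show IsWord x from h.2.1) (show IsWord x' from h'.2.1) heq
  rw [key, Set.ncard_union_eq ?_ (h1.union h2) h3, Set.ncard_union_eq ?_ h1 h2,
    Set.ncard_image_of_injective _ consTop_injective, hinj.ncard_image,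
    (insertSnocTop_injOn.mono fun y hy => hy.2.1).ncard_image]
  · simp only [Set.ncard_prod, Set.ncard_univ, Nat.card_fin]
    ring
  · rw [Set.disjoint_left]
    rintro _ ⟨x, hx, rfl⟩ ⟨y, hy, heq⟩
    exact not_topUnique_consTop hx.1 (heq ▸ topUnique_insertTop hy.2.1)
  · rw [Set.disjoint_left]
    rintro _ (⟨x, hx, rfl⟩ | ⟨x, hx, rfl⟩) ⟨y, hy, heq⟩
    · refine insertSnocTop_zero hy.2.1 ?_
      have : y.2.1 + 1 = x.1 := congrArg Prod.fst heq
      rw [heq]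
      simp only [consTop, Fin.cons_zero]
      omega
    · have := topUnique_insertTop (y := (x.1.castSucc, x.2)) hx.2.1
      exact not_topUnique_insertSnocTop (y := y) (by rwa [heq])

theorem deltaLtEq_one : deltaLtEq 1 = 0 := by
  rw [deltaLtEq, Nat.card_eq_zero]
  left
  constructor
  rintro ⟨p, -, ⟨i, j, k, hij, -⟩, -⟩
  omega

theorem deltaLtEq_add_two (n : ℕ) :
    deltaLtEq (n + 2) = (n + 2) * deltaLtEq (n + 1) + n * aLtEq n := by
  rw [deltaLtEq_succ_eq_ncard, deltaLtEq_succ_eq_ncard, aLtEq_eq_ncard, ncard_stopped_succ]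

theorem aLtEq_one : aLtEq 1 = 1 := by
  rw [aLtEq, Nat.card_eq_one_iff_unique]
  refine ⟨inferInstance, ⟨id, fun i v _ => ⟨v, rfl⟩, ?_⟩⟩
  rintro ⟨i, j, k, hij, -⟩
  omega

theorem two_mul_aLtEq_succ (n : ℕ) : 2 * aLtEq (n + 1) = (n + 2).factorial := by
  induction n with
  | zero => simp [aLtEq_one]
  | succ n ih =>
    rw [Nat.factorial_succ, ← ih, aLtEq_eq_ncard, aLtEq_eq_ncard, ncard_avoiders_add_two]
    ring

theorem deltaLtEq_explicit (n : ℕ) : (deltaLtEq (n + 2) : ℚ) =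
    ((n + 2).factorial : ℚ) / 2 * ∑ k ∈ Finset.Icc 3 (n + 2), ((k : ℚ) - 2) / k := by
  induction n with
  | zero => simp [deltaLtEq_add_two, deltaLtEq_one]
  | succ n ih =>
    have ha : (aLtEq (n + 1) : ℚ) = ((n + 2).factorial : ℚ) / 2 := by
      rw [← two_mul_aLtEq_succ]
      push_cast
      ring
    rw [deltaLtEq_add_two, Finset.sum_Icc_succ_top (by omega), Nat.factorial_succ]
    push_cast
    rw [ih, ha]
    field_simp
    ring

/-- `Δ_1 = Δ_2 = 0`, `Δ_n = n·Δ_{n-1} + (n-2)·a_{n-2}` for `n ≥ 3`, and explicitly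
`Δ_n = (n!/2)·Σ_{k=3}^{n} (k-2)/k` for `n ≥ 3`. -/
theorem deltaLtEq_recurrence :
    deltaLtEq 1 = 0 ∧ deltaLtEq 2 = 0 ∧
    (∀ n, 3 ≤ n → deltaLtEq n = n * deltaLtEq (n - 1) + (n - 2) * aLtEq (n - 2)) ∧
    (∀ n, 3 ≤ n → (deltaLtEq n : ℚ)
        = (n.factorial : ℚ) / 2 * ∑ k ∈ Finset.Icc 3 n, ((k : ℚ) - 2) / k) := by
  refine ⟨deltaLtEq_one, by simp [deltaLtEq_add_two, deltaLtEq_one], fun n hn => ?_, fun n hn => ?_⟩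
  · obtain ⟨m, rfl⟩ := Nat.exists_eq_add_of_le' (show 2 ≤ n by omega)
    exact deltaLtEq_add_two m
  · obtain ⟨m, rfl⟩ := Nat.exists_eq_add_of_le' (show 2 ≤ n by omega)
    exact deltaLtEq_explicit m
end

section
/- Let a_n be the number of ordered set partitions of [n] that avoid the condition x_{i1} ≤ x_{i2} = x_{i3} (i.e., there are no indices i1 < i2 < i3 with pos(i2) = pos(i3) and pos(i1) ≤ pos(i2)), with a_0 = 1 and a_1 = 1. Then a_n = n·a_{n−1} + (n−1)·a_{n−2} for all n ≥ 2. -/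
/-- The ordered set partition encoded by `p` contains the condition
`x_{i1} ≤ x_{i2} = x_{i3}` with `i1 < i2 < i3`. -/
def ChainLeEq {n : ℕ} (p : Fin n → Fin n) : Prop :=
  ∃ i j k : Fin n, i < j ∧ j < k ∧ p j = p k ∧ p i ≤ p j

/-- `a_n` is the number of ordered set partitions of `[n]` avoiding the condition
`x_{i1} ≤ x_{i2} = x_{i3}`. -/
noncomputable def aLeEq (n : ℕ) : ℕ :=
  Nat.card {p : Fin n → Fin n // IsOSP p ∧ ¬ ChainLeEq p}

/-- The condition `x_{i1} ≤ x_{i2} = x_{i3}`, `i1 < i2 < i3`, for natural-number labels. -/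
def NatChainLeEq {n : ℕ} (p : Fin n → ℕ) : Prop :=
  ∃ i j k : Fin n, i < j ∧ j < k ∧ p j = p k ∧ p i ≤ p j

/-- Chain-avoiding ordered set partitions of an `n`-element set, as a labelling by natural numbers
together with the number of blocks. -/
def AvoidingLabelling (n : ℕ) : Type :=
  {x : (Fin n → ℕ) × ℕ // Set.range x.1 = Set.Iio x.2 ∧ ¬ NatChainLeEq x.1}

namespace AvoidingLabelling

theorem lt_blocks {n : ℕ} (x : AvoidingLabelling n) (i : Fin n) : x.1.1 i < x.1.2 :=
  x.2.1.subset (Set.mem_range_self i)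

theorem blocks_le {n : ℕ} (x : AvoidingLabelling n) : x.1.2 ≤ n := by
  have h : Finset.univ.image x.1.1 = Finset.Iio x.1.2 := by
    simpa [← Finset.coe_inj] using x.2.1
  simpa [h] using Finset.card_image_le (s := Finset.univ) (f := x.1.1)

/-- The encoding of a labelling as a self-map of `Fin n`. -/
def toFin {n : ℕ} (x : AvoidingLabelling n) : {p : Fin n → Fin n // IsOSP p ∧ ¬ ChainLeEq p} :=
  ⟨fun i => ⟨x.1.1 i, (x.lt_blocks i).trans_le x.blocks_le⟩, by
    constructor
    · intro i v hv
      have h : (v : ℕ) ∈ Set.range x.1.1 := by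
        rw [x.2.1]
        exact lt_of_le_of_lt (Fin.le_def.1 hv) (x.lt_blocks i)
      obtain ⟨j, hj⟩ := h
      exact ⟨j, Fin.ext hj⟩
    · rintro ⟨i, j, k, hij, hjk, h, h'⟩
      exact x.2.2 ⟨i, j, k, hij, hjk, congrArg Fin.val h, h'⟩⟩

theorem ext {n : ℕ} {x y : AvoidingLabelling n} (h : x.1.1 = y.1.1) : x = y := by
  have h2 : x.1.2 = y.1.2 := by
    rw [← Set.Iio_inj, ← x.2.1, ← y.2.1, h]
  exact Subtype.ext (Prod.ext h h2)

theorem toFin_bijective (n : ℕ) : Function.Bijective (toFin (n := n)) := by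
  constructor
  · intro x y h
    refine ext (funext fun i => ?_)
    exact congrArg Fin.val (congrFun (congrArg Subtype.val h) i)
  · rintro ⟨p, hp, hc⟩
    refine ⟨⟨(fun i => (p i : ℕ), Finset.univ.sup fun i => (p i : ℕ) + 1), ?_, ?_⟩, rfl⟩
    · ext v
      simp only [Set.mem_range, Set.mem_Iio, Finset.lt_sup_iff, Finset.mem_univ, true_and,
        Nat.lt_succ_iff]
      constructor
      · rintro ⟨i, rfl⟩
        exact ⟨i, le_rfl⟩
      · rintro ⟨i, hi⟩
        obtain ⟨j, hj⟩ := hp i ⟨v, hi.trans_lt (p i).2⟩ hi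
        exact ⟨j, congrArg Fin.val hj⟩
    · rintro ⟨i, j, k, hij, hjk, h, h'⟩
      exact hc ⟨i, j, k, hij, hjk, Fin.ext h, h'⟩

instance (n : ℕ) : Finite (AvoidingLabelling n) :=
  Finite.of_injective _ (toFin_bijective n).1

theorem aLeEq_eq_card (n : ℕ) : aLeEq n = Nat.card (AvoidingLabelling n) :=
  (Nat.card_eq_of_bijective _ (toFin_bijective n)).symm

theorem range_insertNth {n m : ℕ} {q : Fin n → ℕ} (hq : Set.range q = Set.Iio m)
    (j : Fin (n + 1)) : Set.range (j.insertNth m q : Fin (n + 1) → ℕ) = Set.Iio (m + 1) := by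
  ext v
  simp only [Set.mem_range, Fin.exists_iff_succAbove j, Fin.insertNth_apply_same,
    Fin.insertNth_apply_succAbove, Set.mem_Iio]
  have := Set.ext_iff.1 hq v
  simp only [Set.mem_range, Set.mem_Iio] at this
  rw [this]
  omega

/-- Add a singleton last block `{j}`. -/
def addSingleton {n : ℕ} (j : Fin (n + 1)) (x : AvoidingLabelling n) :
    AvoidingLabelling (n + 1) :=
  ⟨(j.insertNth x.1.2 x.1.1, x.1.2 + 1), range_insertNth x.2.1 j, by
    rintro ⟨a, b, c, hab, hbc, h, h'⟩
    have hlt := x.lt_blocks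
    dsimp only at h h'
    induction a using Fin.succAboveCases j <;> induction b using Fin.succAboveCases j <;>
      induction c using Fin.succAboveCases j <;>
      simp only [Fin.insertNth_apply_same, Fin.insertNth_apply_succAbove,
        Fin.succAbove_lt_succAbove_iff, lt_irrefl] at *
    all_goals try grind
    exact x.2.2 ⟨_, _, _, hab, hbc, h, h'⟩⟩

/-- Add a last block consisting of the first element and one further element `k`. -/
def addPair {n : ℕ} (k : Fin (n + 1)) (x : AvoidingLabelling n) :
    AvoidingLabelling (n + 2) :=
  ⟨(Fin.cons x.1.2 (addSingleton k x).1.1, x.1.2 + 1), by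
    rw [Fin.range_cons, (addSingleton k x).2.1]
    exact Set.insert_eq_of_mem (Nat.lt_succ_self _), by
    rintro ⟨a, b, c, hab, hbc, h, h'⟩
    obtain ⟨b, rfl⟩ := Fin.exists_succ_eq.2 (Fin.ne_zero_of_lt hab)
    obtain ⟨c, rfl⟩ := Fin.exists_succ_eq.2 (Fin.ne_zero_of_lt hbc)
    simp only [Fin.cons_succ] at h h'
    rw [Fin.succ_lt_succ_iff] at hbc
    induction a using Fin.cases with
    | zero =>
      have hlt := x.lt_blocks
      simp only [addSingleton, Fin.cons_zero] at h h'
      induction b using Fin.succAboveCases k <;> induction c using Fin.succAboveCases k <;>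
        simp only [Fin.insertNth_apply_same, Fin.insertNth_apply_succAbove,
          lt_irrefl] at * <;> grind
    | succ a =>
      exact (addSingleton k x).2.2 ⟨a, b, c, Fin.succ_lt_succ_iff.1 hab, hbc, h, h'⟩⟩

theorem addSingleton_injective (n : ℕ) :
    Function.Injective fun y : Fin (n + 1) × AvoidingLabelling n => addSingleton y.1 y.2 := by
  rintro ⟨j, x⟩ ⟨j', x'⟩ h
  have h1 := congrArg (fun z => z.1.1) h
  have h2 := congrArg (fun z => z.1.2) h
  simp only [addSingleton, Nat.add_right_cancel_iff] at h1 h2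
  have hj : j = j' := by
    by_contra hne
    obtain ⟨i, rfl⟩ := Fin.exists_succAbove_eq hne
    have := congrFun h1 (j'.succAbove i)
    rw [Fin.insertNth_apply_same, Fin.insertNth_apply_succAbove] at this
    have := x'.lt_blocks i
    omega
  subst hj
  refine Prod.ext rfl (ext (funext fun i => ?_))
  simpa using congrFun h1 (j.succAbove i)

theorem addPair_injective (n : ℕ) :
    Function.Injective fun y : Fin (n + 1) × AvoidingLabelling n => addPair y.1 y.2 := by
  rintro ⟨k, x⟩ ⟨k', x'⟩ h
  refine addSingleton_injective n (ext (funext fun i => ?_))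
  simpa [addPair] using congrFun (congrArg (fun z => z.1.1) h) i.succ

theorem addSingleton_ne_addPair {n : ℕ} (j : Fin (n + 2)) (x : AvoidingLabelling (n + 1))
    (k : Fin (n + 1)) (y : AvoidingLabelling n) : addSingleton j x ≠ addPair k y := by
  intro h
  have h1 := congrArg (fun z => z.1.1) h
  have h2 := congrArg (fun z => z.1.2) h
  simp only [addSingleton, addPair, Nat.add_right_cancel_iff] at h1 h2
  have key : ∀ i, (Fin.cons y.1.2 (k.insertNth y.1.2 y.1.1 : Fin (n + 1) → ℕ) :
      Fin (n + 2) → ℕ) i = y.1.2 → i = j := by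
    intro i hi
    by_contra hne
    obtain ⟨i, rfl⟩ := Fin.exists_succAbove_eq hne
    rw [← h1, Fin.insertNth_apply_succAbove] at hi
    have := x.lt_blocks i
    omega
  have h0 := key 0 (by simp)
  have hk := key k.succ (by simp)
  exact Fin.succ_ne_zero k (hk.trans h0.symm)

theorem exists_eq_addSingleton {n m : ℕ} {p : Fin (n + 1) → ℕ}
    (hp : Set.range p = Set.Iio (m + 1)) (hc : ¬ NatChainLeEq p) (j : Fin (n + 1)) (hj : p j = m)
    (hu : ∀ i, p i = m → i = j) : ∃ x : AvoidingLabelling n, x.1.2 = m ∧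
      (addSingleton j x).1.1 = p := by
  refine ⟨⟨(j.removeNth p, m), ?_, ?_⟩, rfl, ?_⟩
  · ext v
    have := Set.ext_iff.1 hp v
    simp only [Set.mem_range, Fin.exists_iff_succAbove j, Set.mem_Iio, hj] at this
    simp only [Set.mem_range, Set.mem_Iio, Fin.removeNth_apply]
    constructor
    · rintro ⟨i, rfl⟩
      have h1 := this.1 (Or.inr ⟨i, rfl⟩)
      have h2 : p (j.succAbove i) ≠ m := fun h => Fin.succAbove_ne j i (hu _ h)
      omega
    · intro hv
      exact (this.2 (by omega)).resolve_left (by omega)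
  · rintro ⟨a, b, c, hab, hbc, h, h'⟩
    exact hc ⟨_, _, _, j.succAbove_lt_succAbove_iff.2 hab, j.succAbove_lt_succAbove_iff.2 hbc, h, h'⟩
  · simp only [addSingleton]
    rw [← hj]
    exact Fin.insertNth_self_removeNth j p

theorem exists_eq_addPair {n m : ℕ} {p : Fin (n + 2) → ℕ}
    (hp : Set.range p = Set.Iio (m + 1)) (hc : ¬ NatChainLeEq p) {j k : Fin (n + 2)} (hjk : j < k)
    (hj : p j = m) (hk : p k = m) :
    ∃ (k : Fin (n + 1)) (x : AvoidingLabelling n), (addPair k x).1.1 = p := by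
  have hle : ∀ i, p i ≤ m := fun i => Nat.lt_succ_iff.1 (hp.subset (Set.mem_range_self i))
  have hj0 : j = 0 := by
    by_contra h
    exact hc ⟨0, j, k, Fin.pos_of_ne_zero h, hjk, hj.trans hk.symm, (hle 0).trans hj.ge⟩
  subst hj0
  obtain ⟨k, rfl⟩ := Fin.exists_succ_eq.2 (Fin.ne_zero_of_lt hjk)
  have hrange : Set.range (Fin.tail p) = Set.Iio (m + 1) := by
    have h0 : p 0 ∈ Set.range (Fin.tail p) := ⟨k, hk.trans hj.symm⟩
    rw [← hp, ← Set.insert_eq_of_mem h0, ← Fin.range_cons, Fin.cons_self_tail]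
  have hchain : ¬ NatChainLeEq (Fin.tail p) := by
    rintro ⟨a, b, c, hab, hbc, h, h'⟩
    exact hc ⟨_, _, _, Fin.succ_lt_succ_iff.2 hab, Fin.succ_lt_succ_iff.2 hbc, h, h'⟩
  have hunique : ∀ i, Fin.tail p i = m → i = k := by
    intro i hi
    change p i.succ = m at hi
    by_contra hne
    rcases lt_or_gt_of_ne hne with hlt | hlt
    · exact hc ⟨0, _, _, Fin.succ_pos i, Fin.succ_lt_succ_iff.2 hlt, by omega, by omega⟩
    · exact hc ⟨0, _, _, Fin.succ_pos k, Fin.succ_lt_succ_iff.2 hlt, by omega, by omega⟩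
  obtain ⟨x, hx, h⟩ := exists_eq_addSingleton hrange hchain k hk hunique
  refine ⟨k, x, ?_⟩
  simp only [addPair, hx, h]
  rw [← hj]
  exact Fin.cons_self_tail p

theorem sumElim_bijective (n : ℕ) : Function.Bijective
    (Sum.elim (fun y : Fin (n + 2) × AvoidingLabelling (n + 1) => addSingleton y.1 y.2)
      fun y : Fin (n + 1) × AvoidingLabelling n => addPair y.1 y.2) := by
  constructor
  · exact (addSingleton_injective _).sumElim (addPair_injective _)
      fun _ _ => addSingleton_ne_addPair _ _ _ _
  · rintro ⟨⟨p, m⟩, hp, hc⟩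
    dsimp only at hp hc
    obtain _ | m := m
    · exact absurd (hp.subset (Set.mem_range_self 0)) (by simp)
    obtain ⟨j, hj⟩ : m ∈ Set.range p := by simp [hp]
    by_cases hu : ∀ i, p i = m → i = j
    · obtain ⟨x, -, h⟩ := exists_eq_addSingleton hp hc j hj hu
      exact ⟨Sum.inl (j, x), ext h⟩
    · push Not at hu
      obtain ⟨i, hi, hne⟩ := hu
      obtain ⟨k, x, h⟩ : ∃ (k : Fin (n + 1)) (x : AvoidingLabelling n), (addPair k x).1.1 = p := by
        rcases lt_or_gt_of_ne hne with hlt | hlt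
        · exact exists_eq_addPair hp hc hlt hi hj
        · exact exists_eq_addPair hp hc hlt hj hi
      exact ⟨Sum.inr (k, x), ext h⟩

end AvoidingLabelling

theorem aLeEq_of_le_one {n : ℕ} (hn : n ≤ 1) : aLeEq n = 1 := by
  have : Subsingleton (Fin n) := Fin.subsingleton_iff_le_one.2 hn
  refine Nat.card_eq_one_iff_unique.2 ⟨inferInstance, ⟨⟨id, fun i v _ => ⟨v, rfl⟩, ?_⟩⟩⟩
  rintro ⟨i, j, k, hij, -⟩
  exact hij.ne (Subsingleton.elim i j)

/-- `a_0 = 1`, `a_1 = 1`, and `a_n = n·a_{n-1} + (n-1)·a_{n-2}` for all `n ≥ 2`. -/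
theorem aLeEq_recurrence :
    aLeEq 0 = 1 ∧ aLeEq 1 = 1 ∧
    ∀ n, 2 ≤ n → aLeEq n = n * aLeEq (n - 1) + (n - 1) * aLeEq (n - 2) := by
  refine ⟨aLeEq_of_le_one zero_le_one, aLeEq_of_le_one le_rfl, fun n hn => ?_⟩
  obtain ⟨n, rfl⟩ := Nat.exists_eq_add_of_le' hn
  have h := Nat.card_eq_of_bijective _ (AvoidingLabelling.sumElim_bijective n)
  simp only [Nat.card_sum, Nat.card_prod, Nat.card_fin, ← AvoidingLabelling.aLeEq_eq_card] at h
  exact h.symm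
end

section
/- Let a_n be the number of ordered set partitions of [n] that avoid the condition x_{i1} ≤ x_{i2} = x_{i3} (i.e., there are no indices i1 < i2 < i3 with pos(i2) = pos(i3) and pos(i1) ≤ pos(i2)), and let Δ_n be the number of ordered set partitions of [n] that contain this condition but whose restriction to [n−1] avoids it. Then Δ_1 = Δ_2 = 0, Δ_3 = 2, and Δ_n = (n−1)·Δ_{n−1} + (n−2)·Δ_{n−2} + a_{n−1} − a_{n−2} for all n ≥ 4. -/
/-- `Δ_n` is the number of ordered set partitions of `[n]` that contain the
condition `x_{i1} ≤ x_{i2} = x_{i3}` but whose restriction to `[n-1]` avoids it. -/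
noncomputable def deltaLeEq (n : ℕ) : ℕ :=
  Nat.card {p : Fin n → Fin n // IsOSP p ∧ ChainLeEq p ∧
    ¬ ∃ i j k : Fin n, i.val < n - 1 ∧ j.val < n - 1 ∧ k.val < n - 1 ∧
      i < j ∧ j < k ∧ p j = p k ∧ p i ≤ p j}

namespace OrderedSetPartition

open Set

/-- `p` encodes an ordered set partition: the set of its values is an initial segment of `ℕ`. -/
def HasInitialRange {n : ℕ} (p : Fin n → ℕ) : Prop :=
  ∀ i v, v ≤ p i → ∃ j, p j = v

/-- The triple `i < j < k` witnesses the condition `x_i ≤ x_j = x_k` in `p`. -/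
def Chain {n : ℕ} (p : Fin n → ℕ) (i j k : Fin n) : Prop :=
  i < j ∧ j < k ∧ p j = p k ∧ p i ≤ p j

/-- The last block of the ordered set partition encoded by `p`. -/
def lastBlock {n : ℕ} (p : Fin n → ℕ) : Set (Fin n) :=
  {x | ∀ y, p y ≤ p x}

/-- The ordered set partitions without a chain. -/
def avoiding (n : ℕ) : Set (Fin n → ℕ) :=
  {p | HasInitialRange p ∧ ∀ i j k, ¬ Chain p i j k}

/-- The ordered set partitions which have a chain, and all of whose chains end in the largest
element. -/
def minimallyContaining (n : ℕ) : Set (Fin n → ℕ) :=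
  {p | HasInitialRange p ∧ (∃ i j k, Chain p i j k) ∧ ∀ i j k, Chain p i j k → k.val + 1 = n}

variable {m n : ℕ}

lemma HasInitialRange.lt {p : Fin n → ℕ} (hp : HasInitialRange p) (i : Fin n) : p i < n := by
  have h : Finset.range (p i + 1) ⊆ Finset.univ.image p := by
    intro v hv
    obtain ⟨j, hj⟩ := hp i v (by simpa [Nat.lt_succ_iff] using hv)
    exact Finset.mem_image.2 ⟨j, Finset.mem_univ _, hj⟩
  have h1 := Finset.card_le_card h
  have h2 : (Finset.univ.image p).card ≤ n := by
    simpa using Finset.card_image_le (s := Finset.univ) (f := p)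
  simp only [Finset.card_range] at h1
  omega

lemma finite_hasInitialRange (n : ℕ) : {p : Fin n → ℕ | HasInitialRange p}.Finite :=
  (Set.Finite.pi' fun _ : Fin n => Set.finite_Iio n).subset fun _ hp i => hp.lt i

lemma natCard_eq_ncard (P : (Fin n → Fin n) → Prop) (Q : (Fin n → ℕ) → Prop)
    (h : ∀ p, P p ↔ Q fun i => p i) :
    Nat.card {p : Fin n → Fin n // IsOSP p ∧ P p} =
      {q : Fin n → ℕ | HasInitialRange q ∧ Q q}.ncard := by
  have key : ∀ p : Fin n → Fin n, IsOSP p ↔ HasInitialRange fun i => (p i : ℕ) := by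
    intro p
    constructor
    · intro hp i v hv
      obtain ⟨j, hj⟩ := hp i ⟨v, hv.trans_lt (p i).2⟩ hv
      exact ⟨j, by simp [hj]⟩
    · intro hp i v hv
      obtain ⟨j, hj⟩ := hp i v hv
      exact ⟨j, Fin.ext hj⟩
  rw [← Nat.card_coe_set_eq]
  exact Nat.card_congr
    { toFun := fun p => ⟨fun i => p.1 i, (key _).1 p.2.1, (h _).1 p.2.2⟩
      invFun := fun q => ⟨fun i => ⟨q.1 i, q.2.1.lt i⟩, (key _).2 q.2.1, (h _).2 q.2.2⟩
      left_inv := fun _ => rfl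
      right_inv := fun _ => rfl }

lemma aLeEq_eq_ncard (n : ℕ) : aLeEq n = (avoiding n).ncard := by
  refine natCard_eq_ncard _ (fun q => ∀ i j k, ¬ Chain q i j k) fun p => ?_
  simp only [ChainLeEq, Chain, Fin.ext_iff, Fin.le_def, not_exists]

lemma deltaLeEq_eq_ncard (n : ℕ) : deltaLeEq n = (minimallyContaining n).ncard := by
  refine natCard_eq_ncard _
    (fun q => (∃ i j k, Chain q i j k) ∧ ∀ i j k, Chain q i j k → k.val + 1 = n) fun p => ?_
  refine and_congr ?_ ⟨fun h i j k hc => ?_, ?_⟩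
  · simp only [ChainLeEq, Chain, Fin.ext_iff, Fin.le_def]
  · obtain ⟨h1, h2, h3, h4⟩ := hc
    by_contra hk
    have := k.2
    exact h ⟨i, j, k, by omega, by omega, by omega, h1, h2, Fin.ext h3, h4⟩
  · rintro h ⟨i, j, k, -, -, hk, h1, h2, h3, h4⟩
    have := h i j k ⟨h1, h2, congrArg Fin.val h3, h4⟩
    omega

/-- Deleting the last block is a bijection between the ordered set partitions with a prescribed
last block and the ordered set partitions of the complement of that block. -/
lemma bijOn_comp {e : Fin m → Fin n} (he : e.Injective) (hne : (range e)ᶜ.Nonempty) :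
    BijOn (fun p : Fin n → ℕ => p ∘ e) {p | HasInitialRange p ∧ lastBlock p = (range e)ᶜ}
      {q | HasInitialRange q} := by
  have mem_range {p : Fin n → ℕ} (hp : lastBlock p = (range e)ᶜ) {x y : Fin n}
      (h : p x < p y) : x ∈ range e := by
    by_contra hx
    rw [← mem_compl_iff, ← hp] at hx
    exact absurd (hx y) (by omega)
  have exists_gt {p : Fin n → ℕ} (hp : lastBlock p = (range e)ᶜ) (i : Fin m) :
      ∃ y, p (e i) < p y := by
    by_contra! h
    have : e i ∈ lastBlock p := h
    rw [hp] at this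
    exact this ⟨i, rfl⟩
  refine ⟨?_, ?_, ?_⟩
  · rintro p ⟨hp, hl⟩ i v hv
    obtain ⟨j, hj⟩ := hp (e i) v hv
    obtain ⟨y, hy⟩ := exists_gt hl i
    obtain ⟨k, rfl⟩ := mem_range hl (x := j) (y := y) (by have : v ≤ p (e i) := hv; omega)
    exact ⟨k, hj⟩
  · have key : ∀ p p' : Fin n → ℕ, HasInitialRange p → lastBlock p = (range e)ᶜ →
        lastBlock p' = (range e)ᶜ → p ∘ e = p' ∘ e → ∀ x ∉ range e, p x ≤ p' x := by
      intro p p' hp hl hl' h x hx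
      by_contra! hlt
      obtain ⟨j, hj⟩ := hp x (p' x) hlt.le
      obtain ⟨i, rfl⟩ := mem_range hl (x := j) (y := x) (by omega)
      obtain ⟨y, hy⟩ := exists_gt hl' i
      have hx' : x ∈ lastBlock p' := by rw [hl']; exact hx
      have h1 := hx' y
      have h2 : p (e i) = p' (e i) := congrFun h i
      omega
    rintro p ⟨hp, hl⟩ p' ⟨hp', hl'⟩ h
    funext x
    by_cases hx : x ∈ range e
    · obtain ⟨i, rfl⟩ := hx
      exact congrFun h i
    · exact le_antisymm (key p p' hp hl hl' h x hx) (key p' p hp' hl' hl h.symm x hx)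
  · intro q hq
    set M := sInf (range q)ᶜ with hM
    have hMq : M ∉ range q := Nat.sInf_mem (Set.finite_range q).infinite_compl.nonempty
    have hlt : ∀ i, q i < M := by
      intro i
      by_contra! h
      exact hMq (hq i M h)
    have hsurj : ∀ v < M, ∃ i, q i = v := by
      intro v hv
      by_contra h
      exact absurd (Nat.sInf_le (s := (range q)ᶜ) h) (by omega)
    have hp1 : ∀ i, Function.extend e q (fun _ => M) (e i) = q i := fun i => he.extend_apply ..
    have hp2 : ∀ x ∉ range e, Function.extend e q (fun _ => M) x = M :=
      fun x hx => Function.extend_apply' _ _ _ hx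
    have hle : ∀ x, Function.extend e q (fun _ => M) x ≤ M := by
      intro x
      by_cases hx : x ∈ range e
      · obtain ⟨i, rfl⟩ := hx
        rw [hp1]
        exact (hlt i).le
      · rw [hp2 x hx]
    obtain ⟨z, hz⟩ := hne
    refine ⟨Function.extend e q fun _ => M, ⟨?_, ?_⟩, funext hp1⟩
    · intro i v hv
      rcases (hv.trans (hle i)).lt_or_eq with h | rfl
      · obtain ⟨j, hj⟩ := hsurj v h
        exact ⟨e j, by rw [hp1, hj]⟩
      · exact ⟨z, hp2 z hz⟩
    · ext x
      constructor
      · rintro hx ⟨i, rfl⟩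
        have h1 := hx z
        rw [hp1, hp2 z hz] at h1
        exact absurd (hlt i) (by omega)
      · intro hx y
        rw [hp2 x hx]
        exact hle y

lemma ncard_lastBlock_eq {T : Type*} [Fintype T] {e : T → Fin m → Fin n}
    (he : ∀ t, (e t).Injective) (hne : ∀ t, (range (e t))ᶜ.Nonempty)
    (hinj : Function.Injective fun t => (range (e t))ᶜ)
    {S : Set (Fin n → ℕ)} {S' : Set (Fin m → ℕ)}
    (hS : ∀ p ∈ S, HasInitialRange p) (hS' : ∀ q ∈ S', HasInitialRange q)
    (h : ∀ t p, HasInitialRange p → lastBlock p = (range (e t))ᶜ → (p ∈ S ↔ p ∘ e t ∈ S')) :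
    {p | p ∈ S ∧ ∃ t, lastBlock p = (range (e t))ᶜ}.ncard = Fintype.card T * S'.ncard := by
  have hex (t : T) (q : S') :
      ∃ p, (HasInitialRange p ∧ lastBlock p = (range (e t))ᶜ) ∧ p ∘ e t = q :=
    (bijOn_comp (he t) (hne t)).surjOn (hS' q q.2)
  choose g hg hgq using hex
  rw [← Nat.card_coe_set_eq, ← Nat.card_coe_set_eq, ← Nat.card_eq_fintype_card, ← Nat.card_prod]
  refine (Nat.card_congr (Equiv.ofBijective (fun x : T × S' =>
    (⟨g x.1 x.2, (h x.1 _ (hg _ _).1 (hg _ _).2).2 (by rw [hgq]; exact x.2.2), x.1, (hg _ _).2⟩ :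
      {p | p ∈ S ∧ ∃ t, lastBlock p = (range (e t))ᶜ})) ⟨?_, ?_⟩)).symm
  · rintro ⟨t, q⟩ ⟨t', q'⟩ hx
    have hx : g t q = g t' q' := congrArg Subtype.val hx
    obtain rfl : t = t' := hinj (by
      change (range (e t))ᶜ = (range (e t'))ᶜ
      rw [← (hg t q).2, ← (hg t' q').2, hx])
    have : (q : Fin m → ℕ) = q' := by rw [← hgq t q, ← hgq t q', hx]
    rw [Subtype.ext this]
  · rintro ⟨p, hp, t, ht⟩
    have hq := (h t p (hS p hp) ht).1 hp
    exact ⟨⟨t, ⟨_, hq⟩⟩, Subtype.ext ((bijOn_comp (he t) (hne t)).injOn (hg t _)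
      ⟨hS p hp, ht⟩ (hgq t _))⟩

lemma lastBlock_nonempty (p : Fin (n + 1) → ℕ) : (lastBlock p).Nonempty :=
  Finite.exists_max p

lemma chain_of_mem_lastBlock {p : Fin n → ℕ} {i j k : Fin n} (hij : i < j) (hjk : j < k)
    (hj : j ∈ lastBlock p) (hk : k ∈ lastBlock p) : Chain p i j k :=
  ⟨hij, hjk, le_antisymm (hk j) (hj k), hj i⟩

lemma chain_comp {e : Fin m → Fin n} (he : StrictMono e) {p : Fin n → ℕ} {i j k : Fin m} :
    Chain (p ∘ e) i j k ↔ Chain p (e i) (e j) (e k) := by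
  simp [Chain, he.lt_iff_lt]

lemma Chain.mem_lastBlock_or {e : Fin m → Fin n} {p : Fin n → ℕ}
    (hl : lastBlock p = (range e)ᶜ) {i j k : Fin n} (h : Chain p i j k) :
    (j ∈ lastBlock p ∧ k ∈ lastBlock p) ∨ ∃ i' j' k', e i' = i ∧ e j' = j ∧ e k' = k := by
  obtain ⟨h1, h2, h3, h4⟩ := h
  by_cases hj : j ∈ lastBlock p
  · exact .inl ⟨hj, fun y => h3 ▸ hj y⟩
  · have hr : ∀ x, x ∉ lastBlock p → x ∈ range e := by
      intro x hx
      rwa [hl, notMem_compl_iff] at hx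
    obtain ⟨i', hi⟩ := hr i fun hi => hj fun y => (hi y).trans h4
    obtain ⟨k', hk⟩ := hr k fun hk => hj fun y => h3 ▸ hk y
    obtain ⟨j', hj⟩ := hr j hj
    exact .inr ⟨i', j', k', hi, hj, hk⟩

lemma mem_avoiding_iff_comp {e : Fin m → Fin n} (he : StrictMono e) (hne : (range e)ᶜ.Nonempty)
    {p : Fin n → ℕ} (hp : HasInitialRange p) (hl : lastBlock p = (range e)ᶜ)
    (hB : ∀ j ∈ lastBlock p, ∀ k ∈ lastBlock p, j < k → j.val = 0) :
    p ∈ avoiding n ↔ p ∘ e ∈ avoiding m := by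
  have hs : HasInitialRange (p ∘ e) := (bijOn_comp he.injective hne).mapsTo ⟨hp, hl⟩
  refine ⟨fun h => ⟨hs, fun i j k hc => h.2 _ _ _ ((chain_comp he).1 hc)⟩,
    fun h => ⟨hp, fun i j k hc => ?_⟩⟩
  rcases hc.mem_lastBlock_or hl with ⟨hj, hk⟩ | ⟨i', j', k', rfl, rfl, rfl⟩
  · have h1 := hB j hj k hk hc.2.1
    have h2 := Fin.lt_def.1 hc.1
    omega
  · exact h.2 _ _ _ ((chain_comp he).2 hc)

lemma mem_minimallyContaining_iff_comp {e : Fin (m + 1) → Fin (n + 1)} (he : StrictMono e)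
    (hlast : e (Fin.last m) = Fin.last n) (hne : (range e)ᶜ.Nonempty)
    {p : Fin (n + 1) → ℕ} (hp : HasInitialRange p) (hl : lastBlock p = (range e)ᶜ)
    (hB : ∀ j ∈ lastBlock p, ∀ k ∈ lastBlock p, j < k → j.val = 0) :
    p ∈ minimallyContaining (n + 1) ↔ p ∘ e ∈ minimallyContaining (m + 1) := by
  have hs : HasInitialRange (p ∘ e) := (bijOn_comp he.injective hne).mapsTo ⟨hp, hl⟩
  have hlift : ∀ i j k, Chain p i j k → ∃ i' j' k', e i' = i ∧ e j' = j ∧ e k' = k := by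
    intro i j k hc
    rcases hc.mem_lastBlock_or hl with ⟨hj, hk⟩ | h
    · have h1 := hB j hj k hk hc.2.1
      have h2 := Fin.lt_def.1 hc.1
      omega
    · exact h
  have hend : ∀ k, (e k).val + 1 = n + 1 ↔ k.val + 1 = m + 1 := by
    intro k
    have h1 : e k = Fin.last n ↔ k = Fin.last m := by rw [← hlast, he.injective.eq_iff]
    simpa [Fin.ext_iff] using h1
  refine ⟨fun h => ⟨hs, ?_, fun i j k hc => (hend k).1 (h.2.2 _ _ _ ((chain_comp he).1 hc))⟩,
    fun h => ⟨hp, ?_, fun i j k hc => ?_⟩⟩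
  · obtain ⟨i, j, k, hc⟩ := h.2.1
    obtain ⟨i', j', k', rfl, rfl, rfl⟩ := hlift i j k hc
    exact ⟨i', j', k', (chain_comp he).2 hc⟩
  · obtain ⟨i, j, k, hc⟩ := h.2.1
    exact ⟨_, _, _, (chain_comp he).1 hc⟩
  · obtain ⟨i', j', k', rfl, rfl, rfl⟩ := hlift i j k hc
    exact (hend k').2 (h.2.2 _ _ _ ((chain_comp he).2 hc))

lemma mem_minimallyContaining_iff_comp_mem_avoiding {e : Fin m → Fin (n + 1)} (he : StrictMono e)
    {p : Fin (n + 1) → ℕ} (hp : HasInitialRange p) (hl : lastBlock p = (range e)ᶜ)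
    (hmem : Fin.last n ∈ lastBlock p) {j₀ : Fin (n + 1)} (hj₀ : j₀ ∈ lastBlock p)
    (hj₀pos : 0 < j₀) (hj₀lt : j₀ < Fin.last n)
    (hB : ∀ j ∈ lastBlock p, ∀ k ∈ lastBlock p, j < k → k < Fin.last n → j.val = 0) :
    p ∈ minimallyContaining (n + 1) ↔ p ∘ e ∈ avoiding m := by
  have hs : HasInitialRange (p ∘ e) :=
    (bijOn_comp he.injective ⟨_, hl ▸ hmem⟩).mapsTo ⟨hp, hl⟩
  refine ⟨fun h => ⟨hs, fun i j k hc => ?_⟩, fun h => ⟨hp,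
    ⟨0, j₀, Fin.last n, chain_of_mem_lastBlock hj₀pos hj₀lt hj₀ hmem⟩, fun i j k hc => ?_⟩⟩
  · have h1 := h.2.2 _ _ _ ((chain_comp he).1 hc)
    have h2 : e k = Fin.last n := Fin.ext (by simpa using h1)
    rw [hl, ← h2] at hmem
    exact hmem ⟨k, rfl⟩
  · rcases hc.mem_lastBlock_or hl with ⟨hj, hk⟩ | ⟨i', j', k', rfl, rfl, rfl⟩
    · by_contra hkn
      have h1 := hB j hj k hk hc.2.1 (by rw [Fin.lt_def, Fin.val_last]; omega)
      have h2 := Fin.lt_def.1 hc.1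
      omega
    · exact absurd ((chain_comp he).2 hc) (h.2 _ _ _)

lemma eq_singleton_or_eq_pair {s : Set (Fin (n + 1))} (hs : s.Nonempty)
    (h : ∀ j ∈ s, ∀ k ∈ s, j < k → j = 0) : (∃ i, s = {i}) ∨ ∃ j ≠ 0, s = {0, j} := by
  by_cases h0 : ∃ j ∈ s, j ≠ 0
  · obtain ⟨j, hj, hj0⟩ := h0
    have huniq : ∀ k ∈ s, k = 0 ∨ k = j := by
      intro k hk
      rcases lt_trichotomy k j with hlt | heq | hgt
      · exact .inl (h k hk j hj hlt)
      · exact .inr heq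
      · exact absurd (h j hj k hk hgt) hj0
    by_cases hz : (0 : Fin (n + 1)) ∈ s
    · refine .inr ⟨j, hj0, Set.ext fun k => ⟨huniq k, ?_⟩⟩
      rintro (rfl | rfl) <;> assumption
    · refine .inl ⟨j, Set.ext fun k => ⟨fun hk => ?_, ?_⟩⟩
      · rcases huniq k hk with rfl | rfl
        · exact absurd hk hz
        · rfl
      · rintro rfl; exact hj
  · push Not at h0
    exact .inl ⟨0, Set.eq_singleton_iff_nonempty_unique_mem.2 ⟨hs, h0⟩⟩

lemma compl_range_comp_succAbove (f : Fin (n + 1) → Fin m) (hf : f.Injective) (i : Fin (n + 1)) :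
    (range (f ∘ i.succAbove))ᶜ = insert (f i) (range f)ᶜ := by
  rw [range_comp, Fin.range_succAbove, image_compl_eq_range_sdiff_image hf, sdiff_eq, compl_inter,
    compl_compl, image_singleton, union_comm]
  rfl

lemma compl_range_succ : (range (Fin.succ : Fin n → Fin (n + 1)))ᶜ = {0} := by
  rw [Fin.range_succ, compl_compl]

lemma compl_range_castSucc : (range (Fin.castSucc : Fin n → Fin (n + 1)))ᶜ = {Fin.last n} := by
  ext x
  induction x using Fin.lastCases <;> simp [Fin.castSucc_ne_last]

lemma compl_range_castSucc_comp_succ :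
    (range (Fin.castSucc ∘ Fin.succ : Fin n → Fin (n + 2)))ᶜ = {0, Fin.last (n + 1)} := by
  have h := compl_range_comp_succAbove (Fin.castSucc : Fin (n + 1) → Fin (n + 2))
    (Fin.castSucc_injective _) 0
  rw [compl_range_castSucc] at h
  simpa [Fin.succAbove_zero] using h

lemma compl_range_comp_succAbove_nonempty (f : Fin (n + 1) → Fin m) (hf : f.Injective)
    (i : Fin (n + 1)) : (range (f ∘ i.succAbove))ᶜ.Nonempty := by
  rw [compl_range_comp_succAbove f hf]
  exact insert_nonempty _ _

lemma injective_compl_range_comp_succAbove (f : Fin (n + 1) → Fin m) (hf : f.Injective) :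
    Function.Injective fun i : Fin (n + 1) => (range (f ∘ i.succAbove))ᶜ := by
  intro i j h
  simp only [compl_range_comp_succAbove f hf] at h
  have hi : f i ∈ insert (f j) (range f)ᶜ := h ▸ mem_insert _ _
  rcases hi with hi | hi
  · exact hf hi
  · exact absurd ⟨i, rfl⟩ hi

/-- Counting by last blocks: `c` parametrizes the elements of the last block which are not already
outside the range of `f`. -/
lemma ncard_lastBlock_eq_insert {k l : ℕ} {f : Fin (n + 1) → Fin m} (hf : StrictMono f)
    {c : Fin k → Fin (n + 1)} (hc : c.Injective) {B : Set (Fin m)} (hB : (range f)ᶜ = B)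
    {S : Set (Fin m → ℕ)} {S' : Set (Fin n → ℕ)}
    (hS : ∀ p ∈ S, HasInitialRange p) (hS' : ∀ q ∈ S', HasInitialRange q)
    (hl : l = S'.ncard)
    (h : ∀ t p, StrictMono (f ∘ (c t).succAbove) → (range (f ∘ (c t).succAbove))ᶜ.Nonempty →
      HasInitialRange p → lastBlock p = (range (f ∘ (c t).succAbove))ᶜ →
      lastBlock p = insert (f (c t)) B →
      (p ∈ S ↔ p ∘ (f ∘ (c t).succAbove) ∈ S')) :
    {p | p ∈ S ∧ ∃ t, lastBlock p = insert (f (c t)) B}.ncard = k * l := by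
  have hmono : ∀ t, StrictMono (f ∘ (c t).succAbove) :=
    fun t => hf.comp (Fin.strictMono_succAbove _)
  have hne := fun t => compl_range_comp_succAbove_nonempty f hf.injective (c t)
  have hr := fun t => compl_range_comp_succAbove f hf.injective (c t)
  have key := ncard_lastBlock_eq (e := fun t => f ∘ (c t).succAbove) (fun t => (hmono t).injective)
    hne ((injective_compl_range_comp_succAbove f hf.injective).comp hc) hS hS'
    fun t p hp hlp => h t p (hmono t) (hne t) hp hlp (by rw [hlp, hr, hB])
  simpa only [hr, hB, Fintype.card_fin, ← hl] using key

lemma ncard_avoiding_add_two (n : ℕ) : (avoiding (n + 2)).ncard =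
    (n + 2) * (avoiding (n + 1)).ncard + (n + 1) * (avoiding n).ncard := by
  have h1 : {p | p ∈ avoiding (n + 2) ∧ ∃ t : Fin (n + 2), lastBlock p = insert t ∅}.ncard =
      (n + 2) * (avoiding (n + 1)).ncard :=
    ncard_lastBlock_eq_insert (f := id) (c := id) strictMono_id Function.injective_id (by simp)
      (fun _ h => h.1) (fun _ h => h.1) rfl fun t p he hne hp hl hl' =>
        mem_avoiding_iff_comp he hne hp hl (by rw [hl']; simp)
  have h2 : {p | p ∈ avoiding (n + 2) ∧ ∃ t : Fin (n + 1), lastBlock p = insert t.succ {0}}.ncard =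
      (n + 1) * (avoiding n).ncard :=
    ncard_lastBlock_eq_insert (f := Fin.succ) (c := id) Fin.strictMono_succ Function.injective_id
      compl_range_succ (fun _ h => h.1) (fun _ h => h.1) rfl fun t p he hne hp hl hl' =>
        mem_avoiding_iff_comp he hne hp hl (by rw [hl']; simp)
  have hfin : (avoiding (n + 2)).Finite := (finite_hasInitialRange _).subset fun _ h => h.1
  rw [← h1, ← h2, ← ncard_union_eq _ (hfin.subset fun _ h => h.1) (hfin.subset fun _ h => h.1)]
  · congr 1
    ext p
    refine ⟨fun hp => ?_, fun hp => hp.elim And.left And.left⟩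
    rcases eq_singleton_or_eq_pair (lastBlock_nonempty p) (fun j hj k hk hjk => by
      by_contra h0
      exact hp.2 _ _ _ (chain_of_mem_lastBlock (Fin.pos_of_ne_zero h0) hjk hj hk))
      with ⟨i, hi⟩ | ⟨j, hj0, hj⟩
    · exact .inl ⟨hp, i, by rw [hi]; simp⟩
    · obtain ⟨j, rfl⟩ := Fin.exists_succ_eq.2 hj0
      exact .inr ⟨hp, j, by rw [hj, pair_comm]⟩
  · rw [disjoint_left]
    rintro p ⟨-, t, ht⟩ ⟨-, s, hs⟩
    rw [ht] at hs
    have h0 := Set.ext_iff.1 hs 0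
    have h1 := Set.ext_iff.1 hs s.succ
    simp only [insert_empty_eq, mem_insert_iff, mem_singleton_iff, Fin.ext_iff, Fin.val_succ,
      Fin.val_zero, or_true, true_or, iff_true] at h0 h1
    omega

lemma ncard_minimallyContaining_add_three (n : ℕ) : (minimallyContaining (n + 3)).ncard =
    (n + 2) * (minimallyContaining (n + 2)).ncard + (n + 1) * (minimallyContaining (n + 1)).ncard +
      (n + 1) * (avoiding (n + 1)).ncard + (n + 1) * (avoiding n).ncard := by
  have h1 : {p | p ∈ minimallyContaining (n + 3) ∧
      ∃ t : Fin (n + 2), lastBlock p = insert t.castSucc ∅}.ncard =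
      (n + 2) * (minimallyContaining (n + 2)).ncard :=
    ncard_lastBlock_eq_insert (f := id) (c := Fin.castSucc) strictMono_id
      (Fin.castSucc_injective _) (by simp)
      (fun _ h => h.1) (fun _ h => h.1) rfl fun t p he hne hp hl hl' =>
        mem_minimallyContaining_iff_comp he (by simp) hne hp hl (by rw [hl']; simp)
  have h2 : {p | p ∈ minimallyContaining (n + 3) ∧
      ∃ t : Fin (n + 1), lastBlock p = insert t.castSucc.succ {0}}.ncard =
      (n + 1) * (minimallyContaining (n + 1)).ncard :=
    ncard_lastBlock_eq_insert (f := Fin.succ) (c := Fin.castSucc) Fin.strictMono_succ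
      (Fin.castSucc_injective _)
      compl_range_succ (fun _ h => h.1) (fun _ h => h.1) rfl fun t p he hne hp hl hl' =>
        mem_minimallyContaining_iff_comp he (by simp) hne hp hl (by rw [hl']; simp)
  have h3 : {p | p ∈ minimallyContaining (n + 3) ∧
      ∃ t : Fin (n + 1), lastBlock p = insert t.succ.castSucc {Fin.last (n + 2)}}.ncard =
      (n + 1) * (avoiding (n + 1)).ncard :=
    ncard_lastBlock_eq_insert (f := Fin.castSucc) (c := Fin.succ) Fin.strictMono_castSucc
      (Fin.succ_injective _)
      compl_range_castSucc (fun _ h => h.1) (fun _ h => h.1) rfl fun t p he hne hp hl hl' =>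
        mem_minimallyContaining_iff_comp_mem_avoiding he hp hl (by rw [hl']; simp)
          (j₀ := t.succ.castSucc) (by rw [hl']; simp) (by simp [Fin.lt_def])
          (Fin.castSucc_lt_last _) (by rw [hl']; simpa using Fin.le_last _)
  have h4 : {p | p ∈ minimallyContaining (n + 3) ∧
      ∃ t : Fin (n + 1), lastBlock p = insert t.succ.castSucc {0, Fin.last (n + 2)}}.ncard =
      (n + 1) * (avoiding n).ncard :=
    ncard_lastBlock_eq_insert (f := Fin.castSucc ∘ Fin.succ) (c := id)
      (Fin.strictMono_castSucc.comp Fin.strictMono_succ) Function.injective_id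
      compl_range_castSucc_comp_succ (fun _ h => h.1) (fun _ h => h.1) rfl
      fun t p he hne hp hl hl' =>
        mem_minimallyContaining_iff_comp_mem_avoiding he hp hl (by rw [hl']; simp)
          (j₀ := t.succ.castSucc) (by rw [hl']; simp) (by simp [Fin.lt_def])
          (Fin.castSucc_lt_last _) (by rw [hl']; simpa using Fin.le_last _)
  have hfin : (minimallyContaining (n + 3)).Finite :=
    (finite_hasInitialRange _).subset fun _ h => h.1
  have hsep : ∀ P : (Fin (n + 3) → ℕ) → Prop, {p | p ∈ minimallyContaining (n + 3) ∧ P p}.Finite :=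
    fun P => hfin.subset fun _ h => h.1
  rw [← h1, ← h2, ← h3, ← h4, ← ncard_union_eq _ (hsep _) (hsep _),
    ← ncard_union_eq _ ((hsep _).union (hsep _)) (hsep _),
    ← ncard_union_eq _ (((hsep _).union (hsep _)).union (hsep _)) (hsep _)]
  · congr 1
    ext p
    refine ⟨fun hp => ?_, fun hp => ?_⟩
    · have hnotlast : ∀ x ≠ Fin.last (n + 2), x.val + 1 ≠ n + 3 := fun x hx h =>
        hx (Fin.ext (by simpa using h))
      have hsmall : ∀ j ∈ lastBlock p, ∀ k ∈ lastBlock p, k ≠ Fin.last (n + 2) → j < k → j = 0 := by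
        intro j hj k hk hkn hjk
        by_contra h0
        exact hnotlast k hkn
          (hp.2.2 _ _ _ (chain_of_mem_lastBlock (Fin.pos_of_ne_zero h0) hjk hj hk))
      have hmid : ∀ x : Fin (n + 3), x ≠ 0 → x ≠ Fin.last (n + 2) →
          ∃ t : Fin (n + 1), t.succ.castSucc = x := by
        intro x h0 hn
        obtain ⟨y, rfl⟩ := Fin.exists_castSucc_eq.2 hn
        obtain ⟨t, rfl⟩ := Fin.exists_succ_eq.2 (show y ≠ 0 by rintro rfl; exact h0 rfl)
        exact ⟨t, rfl⟩
      by_cases hlast : Fin.last (n + 2) ∈ lastBlock p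
      · obtain ⟨i, j, k, hc⟩ := hp.2.1
        obtain rfl : k = Fin.last (n + 2) := by
          by_contra hk
          exact hnotlast k hk (hp.2.2 _ _ _ hc)
        have hj : j ∈ lastBlock p \ {Fin.last (n + 2)} :=
          ⟨fun y => hc.2.2.1 ▸ hlast y, hc.2.1.ne⟩
        have hj0 : j ≠ 0 := Fin.ne_zero_of_lt hc.1
        have hB : lastBlock p = insert (Fin.last (n + 2)) (lastBlock p \ {Fin.last (n + 2)}) := by
          rw [insert_sdiff_singleton, insert_eq_of_mem hlast]
        rcases eq_singleton_or_eq_pair ⟨j, hj⟩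
          fun j hj k hk => hsmall j hj.1 k hk.1 hk.2 with ⟨x, hx⟩ | ⟨x, hx0, hx⟩
        · obtain rfl : j = x := by rwa [hx] at hj
          obtain ⟨t, rfl⟩ := hmid j hj0 hj.2
          exact .inl (.inr ⟨hp, t, by rw [hB, hx, pair_comm]⟩)
        · have hxn : x ∈ lastBlock p \ {Fin.last (n + 2)} := by rw [hx]; simp
          obtain ⟨t, rfl⟩ := hmid x hx0 hxn.2
          refine .inr ⟨hp, t, ?_⟩
          rw [hB, hx, pair_comm, insert_comm, pair_comm]
      · have hne : ∀ k ∈ lastBlock p, k ≠ Fin.last (n + 2) := by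
          rintro k hk rfl
          exact hlast hk
        left; left
        rcases eq_singleton_or_eq_pair (lastBlock_nonempty p)
          fun j hj k hk => hsmall j hj k hk (hne k hk) with ⟨i, hi⟩ | ⟨j, hj0, hj⟩
        · obtain ⟨t, rfl⟩ := Fin.exists_castSucc_eq.2 (hne i (by rw [hi]; rfl))
          exact .inl ⟨hp, t, by rw [hi]; simp⟩
        · obtain ⟨t, rfl⟩ := hmid j hj0 (hne j (by rw [hj]; simp))
          exact .inr ⟨hp, t, by rw [hj, pair_comm]; simp⟩
    · rcases hp with ((hp | hp) | hp) | hp <;> exact hp.1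
  · rw [disjoint_left]
    rintro p ((⟨-, t, ht⟩ | ⟨-, t, ht⟩) | ⟨-, t, ht⟩) ⟨-, s, hs⟩ <;> rw [ht] at hs <;>
    · have h0 := Set.ext_iff.1 hs 0
      have h1 := Set.ext_iff.1 hs (Fin.last _)
      simp only [insert_empty_eq, mem_insert_iff, mem_singleton_iff, Fin.ext_iff, Fin.val_succ,
        Fin.val_castSucc, Fin.val_zero, Fin.val_last, or_true, true_or, iff_true] at h0 h1
      omega
  · rw [disjoint_left]
    rintro p (⟨-, t, ht⟩ | ⟨-, t, ht⟩) ⟨-, s, hs⟩ <;> rw [ht] at hs <;>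
    · have h1 := Set.ext_iff.1 hs (Fin.last _)
      simp only [insert_empty_eq, mem_insert_iff, mem_singleton_iff, Fin.ext_iff, Fin.val_succ,
        Fin.val_castSucc, Fin.val_zero, Fin.val_last, or_true, iff_true] at h1
      omega
  · rw [disjoint_left]
    rintro p ⟨-, t, ht⟩ ⟨-, s, hs⟩
    rw [ht] at hs
    have h0 := Set.ext_iff.1 hs 0
    have h1 := Set.ext_iff.1 hs s.castSucc.succ
    simp only [insert_empty_eq, mem_insert_iff, mem_singleton_iff, Fin.ext_iff, Fin.val_succ,
      Fin.val_castSucc, Fin.val_zero, or_true, true_or, iff_true] at h0 h1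
    omega

lemma minimallyContaining_eq_empty (hn : n ≤ 2) : minimallyContaining n = ∅ := by
  rw [eq_empty_iff_forall_notMem]
  rintro p ⟨-, ⟨i, j, k, hij, hjk, -⟩, -⟩
  have := k.2
  rw [Fin.lt_def] at hij hjk
  omega

lemma ncard_avoiding_of_le_one (hn : n ≤ 1) : (avoiding n).ncard = 1 := by
  rw [ncard_eq_one]
  refine ⟨fun _ => 0, eq_singleton_iff_unique_mem.2 ⟨⟨?_, ?_⟩, fun p hp => ?_⟩⟩
  · intro i v hv
    exact ⟨i, (Nat.le_zero.1 hv).symm⟩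
  · rintro i j k ⟨hij, -⟩
    have := j.2
    rw [Fin.lt_def] at hij
    omega
  · funext i
    have := hp.1.lt i
    omega

end OrderedSetPartition

open OrderedSetPartition in
/-- `Δ_1 = Δ_2 = 0`, `Δ_3 = 2`, and
`Δ_n = (n-1)·Δ_{n-1} + (n-2)·Δ_{n-2} + a_{n-1} - a_{n-2}` for all `n ≥ 4`. -/
theorem deltaLeEq_recurrence :
    deltaLeEq 1 = 0 ∧ deltaLeEq 2 = 0 ∧ deltaLeEq 3 = 2 ∧
    ∀ n, 4 ≤ n → (deltaLeEq n : ℤ)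
        = ((n : ℤ) - 1) * deltaLeEq (n - 1) + ((n : ℤ) - 2) * deltaLeEq (n - 2)
          + aLeEq (n - 1) - aLeEq (n - 2) := by
  simp only [deltaLeEq_eq_ncard, aLeEq_eq_ncard]
  have h1 : (minimallyContaining 1).ncard = 0 := by
    rw [minimallyContaining_eq_empty (by norm_num), Set.ncard_empty]
  have h2 : (minimallyContaining 2).ncard = 0 := by
    rw [minimallyContaining_eq_empty le_rfl, Set.ncard_empty]
  refine ⟨h1, h2, ?_, fun n hn => ?_⟩
  · rw [ncard_minimallyContaining_add_three 0]
    simp [h1, h2, ncard_avoiding_of_le_one]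
  · obtain ⟨n, rfl⟩ := Nat.exists_eq_add_of_le' (show 3 ≤ n by omega)
    rw [show n + 3 - 1 = n + 2 from rfl, show n + 3 - 2 = n + 1 from rfl,
      ncard_minimallyContaining_add_three, ncard_avoiding_add_two]
    push_cast
    ring
end
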